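/- arXiv:1605.04322 — 2 statements merged into one kernel-verified Lean document; each statement's English description precedes it below -/
import Mathlib

section
/- Let 0 < m < n and l ≥ 1. Let B₁, …, B_l be real symmetric positive semi-definite n × n matrices such that B(t) := Σ_{j=1}^{l} t_j B_j is positive definite for every t ∈ (0,∞)ˡ, let m₁, …, m_l be positive real numbers, and let C be a real symmetric positive semi-definite m × m matrix. For B(t) written in blocks with upper-left m × m block, let S(B(t)) := B(t)₁₁ − B(t)₁₂ B(t)₂₂⁻¹ B(t)₂₁ be its Schur complement and B(t)₂₂ its trailing (n−m) × (n−m) block. Then the function F(D) := ∫_{(0,∞)ˡ} exp(−Σ_j t_j m_j² − tr(C · S(B(t)))) · (det B(t)₂₂)^{−D/2} dt is well defined (the integrand is integrable) and holomorphic on the half-plane {D ∈ ℂ : Re D < 0}, and there exists a meromorphic function on all of ℂ which agrees with F on that half-plane. (F(D) is, up to the factor π^{(n−m)D/2}, the D-dimensional integral I^D_{E,F}(f)(C) of the Feynman type function f(A) = ∏_j (tr(A B_j) + m_j²)^{−1}.) -/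
open Matrix MeasureTheory Finset

noncomputable section

variable {m n l : ℕ}

/-- `B(t) = Σ_j t_j B_j`. -/
def Bt (B : Fin l → Matrix (Fin m ⊕ Fin (n - m)) (Fin m ⊕ Fin (n - m)) ℝ)
    (t : Fin l → ℝ) : Matrix (Fin m ⊕ Fin (n - m)) (Fin m ⊕ Fin (n - m)) ℝ :=
  ∑ j, t j • B j

/-- The Schur complement `S(B(t)) = B(t)₁₁ − B(t)₁₂ B(t)₂₂⁻¹ B(t)₂₁`. -/
def schurBt (B : Fin l → Matrix (Fin m ⊕ Fin (n - m)) (Fin m ⊕ Fin (n - m)) ℝ)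
    (t : Fin l → ℝ) : Matrix (Fin m) (Fin m) ℝ :=
  (Bt B t).toBlocks₁₁ - (Bt B t).toBlocks₁₂ * ((Bt B t).toBlocks₂₂)⁻¹ * (Bt B t).toBlocks₂₁

/-- The integrand `exp(−Σ_j t_j m_j² − tr(C·S(B(t)))) · (det B(t)₂₂)^{−D/2}`. -/
def feynmanIntegrand (B : Fin l → Matrix (Fin m ⊕ Fin (n - m)) (Fin m ⊕ Fin (n - m)) ℝ)
    (mj : Fin l → ℝ) (C : Matrix (Fin m) (Fin m) ℝ) (D : ℂ) (t : Fin l → ℝ) : ℂ :=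
  ((Real.exp (-(∑ j, t j * mj j ^ 2) - (C * schurBt B t).trace) : ℝ) : ℂ) *
    (((Bt B t).toBlocks₂₂.det : ℝ) : ℂ) ^ (-D / 2)

/-- An integral depending holomorphically on a parameter, locally uniformly dominated, is
holomorphic. -/
theorem differentiableOn_integral_of_dominated {X : Type*} [MeasurableSpace X] {μ : Measure X}
    {f : ℂ → X → ℂ} {U : Set ℂ} (hU : IsOpen U)
    (hmeas : ∀ s ∈ U, AEStronglyMeasurable (f s) μ)
    (hdiff : ∀ᵐ x ∂μ, DifferentiableOn ℂ (fun s => f s x) U)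
    (hbound : ∀ s₀ ∈ U, ∃ ε > 0, ∃ g : X → ℝ, Integrable g μ ∧
      ∀ᵐ x ∂μ, ∀ s ∈ Metric.ball s₀ ε, ‖f s x‖ ≤ g x) :
    DifferentiableOn ℂ (fun s => ∫ x, f s x ∂μ) U := by
  intro s₀ hs₀
  obtain ⟨ε, hε, g, hg, hfg⟩ := hbound s₀ hs₀
  obtain ⟨δ, hδ, hδU⟩ := Metric.isOpen_iff.1 hU s₀ hs₀
  set r := min ε δ / 4 with hr
  have hr0 : 0 < r := by positivity
  have hrε : 4 * r ≤ ε := by rw [hr]; linarith [min_le_left ε δ]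
  have hrδ : 4 * r ≤ δ := by rw [hr]; linarith [min_le_right ε δ]
  have hsub : ∀ s, dist s s₀ ≤ 2 * r → s ∈ U ∧ s ∈ Metric.ball s₀ ε := fun s hs =>
    ⟨hδU (Metric.mem_ball.2 (by linarith)), Metric.mem_ball.2 (by linarith)⟩
  have hderivAt : ∀ᵐ x ∂μ, ∀ s ∈ Metric.ball s₀ r,
      HasDerivAt (fun s => f s x) (deriv (fun s => f s x) s) s := by
    filter_upwards [hdiff] with x hx s hs
    rw [Metric.mem_ball] at hs
    exact ((hx s (hsub s (by linarith)).1).differentiableAt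
      (hU.mem_nhds (hsub s (by linarith)).1)).hasDerivAt
  have hseq : Filter.Tendsto (fun n : ℕ => ((r / 2 : ℝ) : ℂ) * (1 / ((n : ℂ) + 1)))
      Filter.atTop (nhds 0) := by
    simpa using (tendsto_one_div_add_atTop_nhds_zero_nat (𝕜 := ℂ)).const_mul ((r / 2 : ℝ) : ℂ)
  have hseq_ne : ∀ n : ℕ, ((r / 2 : ℝ) : ℂ) * (1 / ((n : ℂ) + 1)) ≠ 0 := fun n => by
    have : (n : ℂ) + 1 ≠ 0 := Nat.cast_add_one_ne_zero n
    have h2 : ((r / 2 : ℝ) : ℂ) ≠ 0 := by exact_mod_cast (by positivity : r / 2 ≠ 0)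
    exact mul_ne_zero h2 (one_div_ne_zero this)
  have hseq_mem : ∀ n : ℕ, s₀ + ((r / 2 : ℝ) : ℂ) * (1 / ((n : ℂ) + 1)) ∈ U := fun n => by
    refine (hsub _ ?_).1
    rw [dist_eq_norm, add_sub_cancel_left, norm_mul, norm_div, norm_one, Complex.norm_real,
      Real.norm_of_nonneg (by positivity)]
    have : (1 : ℝ) ≤ ‖(n : ℂ) + 1‖ := by
      rw [← Nat.cast_add_one, Complex.norm_natCast]
      exact_mod_cast Nat.succ_le_succ (Nat.zero_le n)
    have h3 : 1 / ‖(n : ℂ) + 1‖ ≤ 1 := by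
      rw [div_le_one (by linarith)]
      exact this
    nlinarith
  refine (hasDerivAt_integral_of_dominated_loc_of_deriv_le (μ := μ) (F := f) (x₀ := s₀)
    (F' := fun s x => deriv (fun s => f s x) s) (bound := fun x => g x / r)
    (Metric.ball_mem_nhds s₀ hr0) ?_ ?_ ?_ ?_ (hg.div_const r)
    hderivAt).2.differentiableAt.differentiableWithinAt
  · filter_upwards [hU.mem_nhds hs₀] with s hs using hmeas s hs
  · refine hg.mono' (hmeas s₀ hs₀) ?_
    filter_upwards [hfg] with x hx using hx s₀ (Metric.mem_ball_self hε)
  · refine aestronglyMeasurable_of_tendsto_ae Filter.atTop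
      (f := fun (n : ℕ) x => (((r / 2 : ℝ) : ℂ) * (1 / ((n : ℂ) + 1)))⁻¹ •
        (f (s₀ + ((r / 2 : ℝ) : ℂ) * (1 / ((n : ℂ) + 1))) x - f s₀ x)) (fun n => ?_) ?_
    · exact ((hmeas _ (hseq_mem n)).sub (hmeas s₀ hs₀)).const_smul
        (((r / 2 : ℝ) : ℂ) * (1 / ((n : ℂ) + 1)))⁻¹
    · filter_upwards [hderivAt] with x hx
      have := (hx s₀ (Metric.mem_ball_self hr0)).tendsto_slope_zero
      exact this.comp (tendsto_nhdsWithin_iff.2 ⟨hseq, Filter.Eventually.of_forall hseq_ne⟩)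
  · filter_upwards [hfg, hdiff] with x hx hdx s hs
    rw [Metric.mem_ball] at hs
    have hcl : DifferentiableOn ℂ (fun s => f s x) (closure (Metric.ball s r)) := by
      refine hdx.mono fun z hz => ?_
      have hz' := Metric.closure_ball_subset_closedBall hz
      rw [Metric.mem_closedBall] at hz'
      exact (hsub z (by linarith [dist_triangle z s s₀])).1
    refine Complex.norm_deriv_le_of_forall_mem_sphere_norm_le hr0 hcl.diffContOnCl fun z hz => ?_
    rw [Metric.mem_sphere] at hz
    exact hx z (hsub z (by linarith [dist_triangle z s s₀])).2

/-- `g`, a function on the right half-plane, continues meromorphically to `{Re s > -M}`. -/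
def HasContinuation (M : ℝ) (g : ℂ → ℂ) : Prop :=
  ∃ G : ℂ → ℂ, MeromorphicOn G {s | -M < s.re} ∧ ∀ s : ℂ, 0 < s.re → G s = g s

namespace HasContinuation

variable {M : ℝ} {g h : ℂ → ℂ}

theorem congr (hg : HasContinuation M g) (hgh : ∀ s : ℂ, 0 < s.re → g s = h s) :
    HasContinuation M h := by
  obtain ⟨G, hG, hGg⟩ := hg
  exact ⟨G, hG, fun s hs => (hGg s hs).trans (hgh s hs)⟩

theorem add (hg : HasContinuation M g) (hh : HasContinuation M h) :
    HasContinuation M fun s => g s + h s := by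
  obtain ⟨G, hG, hGg⟩ := hg
  obtain ⟨H, hH, hHh⟩ := hh
  exact ⟨G + H, hG.add hH, fun s hs => by simp [hGg s hs, hHh s hs]⟩

theorem mul_meromorphic (hg : HasContinuation M g) (hh : Meromorphic h) :
    HasContinuation M fun s => h s * g s := by
  obtain ⟨G, hG, hGg⟩ := hg
  exact ⟨h * G, fun s hs => (hh s).mul (hG s hs), fun s hs => by simp [hGg s hs]⟩

theorem zero : HasContinuation M fun _ => 0 :=
  ⟨fun _ => 0, fun s _ => MeromorphicAt.const 0 s, fun _ _ => rfl⟩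

theorem sum {J : Type*} (S : Finset J) {F : J → ℂ → ℂ} (hF : ∀ j ∈ S, HasContinuation M (F j)) :
    HasContinuation M fun s => ∑ j ∈ S, F j s := by
  classical
  induction S using Finset.induction_on with
  | empty => simpa using zero
  | insert j S hj ih =>
    simp only [Finset.sum_insert hj]
    exact (hF j (Finset.mem_insert_self j S)).add
      (ih fun i hi => hF i (Finset.mem_insert_of_mem hi))

theorem eventuallyEq_of_rightHalfPlane {N : ℝ} {G H : ℂ → ℂ}
    (hG : MeromorphicOn G {s | -M < s.re}) (hH : MeromorphicOn H {s | -N < s.re})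
    (hGg : ∀ s : ℂ, 0 < s.re → G s = g s) (hHg : ∀ s : ℂ, 0 < s.re → H s = g s)
    {w : ℂ} (hMw : -M < w.re) (hNw : -N < w.re) : G =ᶠ[nhdsWithin w {w}ᶜ] H := by
  have hD : MeromorphicOn (G - H) {s | min w.re 1 ≤ s.re ∧ -M < s.re ∧ -N < s.re} :=
    fun s hs => (hG s hs.2.1).sub (hH s hs.2.2)
  by_cases h1 : -M < 1 ∧ -N < 1
  swap
  · have hw0 : 0 < w.re := by
      by_contra! hw0
      exact h1 ⟨by linarith, by linarith⟩
    refine (Filter.eventually_of_mem ((isOpen_lt continuous_const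
      Complex.continuous_re).mem_nhds hw0) fun s hs => ?_).filter_mono nhdsWithin_le_nhds
    rw [hGg s hs, hHg s hs]
  have hconv : Convex ℝ {s : ℂ | min w.re 1 ≤ s.re ∧ -M < s.re ∧ -N < s.re} :=
    (convex_halfSpace_re_ge _).inter ((convex_halfSpace_re_gt _).inter (convex_halfSpace_re_gt _))
  have hone : meromorphicOrderAt (G - H) 1 = ⊤ := by
    rw [meromorphicOrderAt_eq_top_iff]
    refine (Filter.eventually_of_mem ((isOpen_lt continuous_const
      Complex.continuous_re).mem_nhds (by simp : (0 : ℝ) < (1 : ℂ).re))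
        fun s hs => ?_).filter_mono nhdsWithin_le_nhds
    simp [hGg s hs, hHg s hs]
  have hw : meromorphicOrderAt (G - H) w = ⊤ := by
    by_contra hw
    exact hD.meromorphicOrderAt_ne_top_of_isPreconnected hconv.isPreconnected
      ⟨min_le_left _ _, hMw, hNw⟩ ⟨by simp, by simpa using h1⟩ hw hone
  rw [meromorphicOrderAt_eq_top_iff] at hw
  filter_upwards [hw] with s hs
  exact sub_eq_zero.1 hs

/-- Continuations to all the half-planes `{Re s > -M}` glue to a continuation to `ℂ`. -/
theorem exists_meromorphic (hg : ∀ M : ℕ, HasContinuation M g) :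
    ∃ G : ℂ → ℂ, Meromorphic G ∧ ∀ s : ℂ, 0 < s.re → G s = g s := by
  choose G hG hGg using hg
  have hN : ∀ s : ℂ, ∃ N : ℕ, -(N : ℝ) < s.re := fun s => by
    obtain ⟨N, hN⟩ := exists_nat_gt (-s.re)
    exact ⟨N, by linarith⟩
  choose N hN using hN
  refine ⟨fun s => if 0 < s.re then g s else toMeromorphicNFAt (G (N s)) s s, fun z => ?_,
    fun s hs => if_pos hs⟩
  refine (hG (N z) z (hN z)).congr ?_
  have hopen : IsOpen {s : ℂ | -(N z : ℝ) < s.re} :=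
    isOpen_lt continuous_const Complex.continuous_re
  filter_upwards [(hG (N z)).toMeromorphicNFOn_eq_self_on_nhdsNE (hN z),
    mem_nhdsWithin_of_mem_nhds (hopen.mem_nhds (hN z))] with w hw hzw
  split_ifs with hw0
  · exact hGg _ w hw0
  · rw [← hw, toMeromorphicNFOn_eq_toMeromorphicNFAt (hG (N z)) hzw]
    exact (toMeromorphicNFAt_eventuallyEq_nhds_congr (eventuallyEq_of_rightHalfPlane
      (hG (N z)) (hG (N w)) (hGg _) (hGg _) hzw (hN w))).self_of_nhds

end HasContinuation

/-- The open positive orthant. -/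
def posOrthant (k : ℕ) : Set (Fin k → ℝ) := {v | ∀ i, 0 < v i}

/-- A generalized polynomial in the variables `exp (-v j)`, with real exponents. -/
def posynomial {k : ℕ} {κ : Type*} [Fintype κ] (c : κ → ℝ) (β : κ → Fin k → ℝ)
    (v : Fin k → ℝ) : ℝ :=
  ∑ q, c q * Real.exp (-(β q ⬝ᵥ v))

/-- The exponential `exp (-⟨a + s b, v⟩)` times the product of the powers with exponents
`s α i + γ i` of the posynomials given by `c i` and `β i`. -/
def eulerIntegrand {k : ℕ} {ι κ : Type*} [Fintype ι] [Fintype κ] (c : ι → κ → ℝ)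
    (β : ι → κ → Fin k → ℝ) (a b : Fin k → ℝ) (α γ : ι → ℝ) (s : ℂ) (v : Fin k → ℝ) : ℂ :=
  Complex.exp (-((a ⬝ᵥ v : ℝ) : ℂ) - s * ((b ⬝ᵥ v : ℝ) : ℂ) +
    ∑ i, (s * (α i : ℂ) + (γ i : ℂ)) * ((Real.log (posynomial (c i) (β i) v) : ℝ) : ℂ))

/-- The posynomials have nonnegative coefficients, no negative exponents and a positive
constant term. -/
structure IsMonomialized {k : ℕ} {ι κ : Type*} (c : ι → κ → ℝ) (β : ι → κ → Fin k → ℝ) :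
    Prop where
  coeff_nonneg : ∀ i q, 0 ≤ c i q
  exponent_nonneg : ∀ i q j, 0 ≤ β i q j
  exists_const : ∀ i, ∃ q, 0 < c i q ∧ β i q = 0

theorem IsMonomialized.exists_coeff_pos {k : ℕ} {ι κ : Type*} {c : ι → κ → ℝ}
    {β : ι → κ → Fin k → ℝ} (h : IsMonomialized c β) (i : ι) : ∃ q, 0 < c i q :=
  let ⟨q, hq, _⟩ := h.exists_const i
  ⟨q, hq⟩

section Euler

variable {k : ℕ} {ι κ : Type*} [Fintype ι] [Fintype κ]

theorem posOrthant_eq_pi (k : ℕ) : posOrthant k = Set.univ.pi fun _ => Set.Ioi 0 := by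
  ext v
  simp [posOrthant]

theorem measurableSet_posOrthant (k : ℕ) : MeasurableSet (posOrthant k) := by
  rw [posOrthant_eq_pi]
  exact MeasurableSet.univ_pi fun _ => measurableSet_Ioi

theorem volume_restrict_posOrthant (k : ℕ) :
    (volume : Measure (Fin k → ℝ)).restrict (posOrthant k) =
      Measure.pi fun _ => (volume : Measure ℝ).restrict (Set.Ioi 0) := by
  rw [posOrthant_eq_pi, volume_pi, Measure.restrict_pi_pi]

theorem posynomial_pos {c : κ → ℝ} (hc : ∀ q, 0 ≤ c q) (hc' : ∃ q, 0 < c q)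
    (β : κ → Fin k → ℝ) (v : Fin k → ℝ) : 0 < posynomial c β v := by
  obtain ⟨q, hq⟩ := hc'
  exact Finset.sum_pos' (fun q _ => mul_nonneg (hc q) (Real.exp_nonneg _))
    ⟨q, Finset.mem_univ q, mul_pos hq (Real.exp_pos _)⟩

theorem continuous_posynomial (c : κ → ℝ) (β : κ → Fin k → ℝ) :
    Continuous (posynomial c β) := by
  unfold posynomial dotProduct
  fun_prop

theorem continuous_eulerIntegrand {c : ι → κ → ℝ} (hc : ∀ i q, 0 ≤ c i q)
    (hc' : ∀ i, ∃ q, 0 < c i q) (β : ι → κ → Fin k → ℝ) (a b : Fin k → ℝ) (α γ : ι → ℝ)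
    (s : ℂ) : Continuous (eulerIntegrand c β a b α γ s) := by
  have hlog : ∀ i, Continuous fun v => Real.log (posynomial (c i) (β i) v) := fun i =>
    (continuous_posynomial _ _).log fun v => (posynomial_pos (hc i) (hc' i) _ _).ne'
  have hdot : ∀ x : Fin k → ℝ, Continuous fun v => x ⬝ᵥ v := fun x => by
    unfold dotProduct
    fun_prop
  unfold eulerIntegrand
  have ha := hdot a
  have hb := hdot b
  fun_prop

theorem norm_eulerIntegrand (c : ι → κ → ℝ) (β : ι → κ → Fin k → ℝ) (a b : Fin k → ℝ)
    (α γ : ι → ℝ) (s : ℂ) (v : Fin k → ℝ) :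
    ‖eulerIntegrand c β a b α γ s v‖ = Real.exp (-((a + s.re • b) ⬝ᵥ v)) *
      Real.exp (∑ i, (s.re * α i + γ i) * Real.log (posynomial (c i) (β i) v)) := by
  rw [eulerIntegrand, Complex.norm_exp, ← Real.exp_add]
  congr 1
  simp [add_dotProduct, smul_dotProduct]
  ring

namespace IsMonomialized

variable {c : ι → κ → ℝ} {β : ι → κ → Fin k → ℝ}

theorem exists_abs_log_le (h : IsMonomialized c β) :
    ∃ Λ : ℝ, 0 ≤ Λ ∧ ∀ i v, (∀ j, 0 ≤ v j) → |Real.log (posynomial (c i) (β i) v)| ≤ Λ := by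
  have hi : ∀ i, ∃ Λ : ℝ, 0 ≤ Λ ∧
      ∀ v, (∀ j, 0 ≤ v j) → |Real.log (posynomial (c i) (β i) v)| ≤ Λ := fun i => by
    obtain ⟨q, hq, hβ⟩ := h.exists_const i
    refine ⟨max |Real.log (c i q)| |Real.log (∑ q, c i q)|, by positivity, fun v hv => ?_⟩
    have hlow : c i q ≤ posynomial (c i) (β i) v := by
      have := Finset.single_le_sum (f := fun q => c i q * Real.exp (-(β i q ⬝ᵥ v)))
        (fun q _ => mul_nonneg (h.coeff_nonneg i q) (Real.exp_nonneg _)) (Finset.mem_univ q)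
      simpa [hβ, posynomial] using this
    have hup : posynomial (c i) (β i) v ≤ ∑ q, c i q := by
      refine Finset.sum_le_sum fun q _ => mul_le_of_le_one_right (h.coeff_nonneg i q) ?_
      rw [Real.exp_le_one_iff, neg_nonpos]
      exact dotProduct_nonneg_of_nonneg (fun j => h.exponent_nonneg i q j) hv
    have h1 := Real.log_le_log hq hlow
    have h2 := Real.log_le_log (hq.trans_le hlow) hup
    exact abs_le_max_abs_abs h1 h2
  choose Λ hΛ0 hΛ using hi
  refine ⟨∑ i, Λ i, Finset.sum_nonneg fun i _ => hΛ0 i, fun i v hv => (hΛ i v hv).trans ?_⟩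
  exact Finset.single_le_sum (fun i _ => hΛ0 i) (Finset.mem_univ i)

end IsMonomialized

theorem integrableOn_exp_neg_dotProduct {x : Fin k → ℝ} (hx : ∀ j, 0 < x j) :
    IntegrableOn (fun v => Real.exp (-(x ⬝ᵥ v))) (posOrthant k) := by
  rw [IntegrableOn, volume_restrict_posOrthant]
  have h1 : ∀ j, Integrable (fun y : ℝ => Real.exp (-x j * y))
      (volume.restrict (Set.Ioi 0)) := fun j =>
    integrableOn_exp_mul_Ioi (neg_neg_of_pos (hx j)) 0
  refine (Integrable.fintype_prod h1).congr (Filter.Eventually.of_forall fun v => ?_)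
  simp only [dotProduct, ← Real.exp_sum, neg_mul, Finset.sum_neg_distrib]

theorem exists_norm_eulerIntegrand_le {c : ι → κ → ℝ} {β : ι → κ → Fin k → ℝ}
    (h : IsMonomialized c β) (a b : Fin k → ℝ) (α γ : ι → ℝ) (R : ℝ) :
    ∃ K : ℝ, ∀ s : ℂ, |s.re| ≤ R → ∀ v, (∀ j, 0 ≤ v j) →
      ‖eulerIntegrand c β a b α γ s v‖ ≤ Real.exp (-((a + s.re • b) ⬝ᵥ v)) * K := by
  obtain ⟨Λ, hΛ0, hΛ⟩ := h.exists_abs_log_le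
  refine ⟨Real.exp (∑ i, (R * |α i| + |γ i|) * Λ), fun s hs v hv => ?_⟩
  rw [norm_eulerIntegrand]
  refine mul_le_mul_of_nonneg_left (Real.exp_le_exp.2 (Finset.sum_le_sum fun i _ => ?_))
    (Real.exp_nonneg _)
  refine (le_abs_self _).trans ?_
  rw [abs_mul]
  have hR : 0 ≤ R := (abs_nonneg _).trans hs
  refine mul_le_mul ?_ (hΛ i v hv) (abs_nonneg _) (by positivity)
  exact (abs_add_le _ _).trans (by rw [abs_mul]; gcongr)

theorem integrableOn_eulerIntegrand {c : ι → κ → ℝ} {β : ι → κ → Fin k → ℝ}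
    (h : IsMonomialized c β) {a b : Fin k → ℝ} (α γ : ι → ℝ) {s : ℂ}
    (hs : ∀ j, 0 < a j + s.re * b j) :
    IntegrableOn (eulerIntegrand c β a b α γ s) (posOrthant k) := by
  obtain ⟨K, hK⟩ := exists_norm_eulerIntegrand_le h a b α γ |s.re|
  refine Integrable.mono' ((integrableOn_exp_neg_dotProduct (x := a + s.re • b)
    (by simpa using hs)).mul_const K) (continuous_eulerIntegrand h.coeff_nonneg
      h.exists_coeff_pos β a b α γ s).aestronglyMeasurable ?_
  filter_upwards [ae_restrict_mem (measurableSet_posOrthant k)] with v hv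
  exact hK s le_rfl v fun j => (hv j).le

theorem differentiableOn_integral_eulerIntegrand {c : ι → κ → ℝ} {β : ι → κ → Fin k → ℝ}
    (h : IsMonomialized c β) {a b : Fin k → ℝ} (α γ : ι → ℝ) {M : ℝ} (hb : ∀ j, 0 ≤ b j)
    (hM : ∀ j, 0 < a j - M * b j) :
    DifferentiableOn ℂ (fun s => ∫ v in posOrthant k, eulerIntegrand c β a b α γ s v)
      {s | -M < s.re} := by
  have hpos : ∀ σ : ℝ, -M < σ → ∀ j, 0 < a j + σ * b j := fun σ hσ j => by
    nlinarith [hM j, mul_nonneg (by linarith : 0 ≤ σ + M) (hb j)]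
  refine differentiableOn_integral_of_dominated
    (isOpen_lt continuous_const Complex.continuous_re)
    (fun s _ => (continuous_eulerIntegrand h.coeff_nonneg
      h.exists_coeff_pos β a b α γ s).aestronglyMeasurable) ?_ fun s₀ hs₀ => ?_
  · refine Filter.Eventually.of_forall fun v => Differentiable.differentiableOn ?_
    unfold eulerIntegrand
    fun_prop
  · rw [Set.mem_ofPred_eq] at hs₀
    obtain ⟨K, hK⟩ := exists_norm_eulerIntegrand_le h a b α γ (|s₀.re| + (s₀.re + M))
    refine ⟨(s₀.re + M) / 2, by linarith,
      fun v => Real.exp (-((a + ((s₀.re - M) / 2) • b) ⬝ᵥ v)) * K,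
      (integrableOn_exp_neg_dotProduct ?_).mul_const K, ?_⟩
    · intro j
      simpa using hpos ((s₀.re - M) / 2) (by linarith) j
    · filter_upwards [ae_restrict_mem (measurableSet_posOrthant k)] with v hv s hs
      have hdist : |s.re - s₀.re| < (s₀.re + M) / 2 := by
        rw [Metric.mem_ball, dist_eq_norm] at hs
        exact (Complex.abs_re_le_norm (s - s₀)).trans_lt hs
      have hK0 : 0 ≤ K := by
        have := (norm_nonneg _).trans (hK s₀ (by linarith) v fun j => (hv j).le)
        exact nonneg_of_mul_nonneg_right this (Real.exp_pos _)
      refine (hK s ?_ v fun j => (hv j).le).trans ?_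
      · have := abs_sub_abs_le_abs_sub s.re s₀.re
        linarith
      · have hb' : 0 ≤ b ⬝ᵥ v := dotProduct_nonneg_of_nonneg hb fun j => (hv j).le
        rw [abs_lt] at hdist
        simp only [add_dotProduct, smul_dotProduct, smul_eq_mul]
        gcongr
        linarith

end Euler

section IntegrationByParts

variable {k : ℕ}

theorem measurePreserving_insertNth_posOrthant (j : Fin (k + 1)) :
    MeasurePreserving (fun p : ℝ × (Fin k → ℝ) => (j.insertNth p.1 p.2 : Fin (k + 1) → ℝ))
      ((volume.restrict (Set.Ioi 0)).prod (volume.restrict (posOrthant k)))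
      (volume.restrict (posOrthant (k + 1))) := by
  rw [volume_restrict_posOrthant, volume_restrict_posOrthant]
  exact (measurePreserving_piFinSuccAbove
    (fun _ : Fin (k + 1) => (volume : Measure ℝ).restrict (Set.Ioi 0)) j).symm

theorem measurableEmbedding_insertNth (j : Fin (k + 1)) :
    MeasurableEmbedding
      (fun p : ℝ × (Fin k → ℝ) => (j.insertNth p.1 p.2 : Fin (k + 1) → ℝ)) :=
  (MeasurableEquiv.piFinSuccAbove (fun _ : Fin (k + 1) => ℝ) j).symm.measurableEmbedding

/-- The integral of a partial derivative over the orthant is a boundary integral. -/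
theorem integral_posOrthant_deriv (j : Fin (k + 1)) {G K : (Fin (k + 1) → ℝ) → ℂ}
    (hG : IntegrableOn G (posOrthant (k + 1))) (hK : IntegrableOn K (posOrthant (k + 1)))
    (hderiv : ∀ w ∈ posOrthant k, ∀ x, 0 ≤ x →
      HasDerivAt (fun x => G (j.insertNth x w)) (K (j.insertNth x w)) x) :
    ∫ v in posOrthant (k + 1), K v = -∫ w in posOrthant k, G (j.insertNth 0 w) := by
  have hmp := measurePreserving_insertNth_posOrthant j
  have hemb := measurableEmbedding_insertNth j
  have hG' := (hmp.integrable_comp_emb hemb).2 hG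
  have hK' : Integrable (fun p : ℝ × (Fin k → ℝ) => K (j.insertNth p.1 p.2))
      ((volume.restrict (Set.Ioi 0)).prod (volume.restrict (posOrthant k))) :=
    (hmp.integrable_comp_emb hemb).2 hK
  rw [← hmp.integral_comp hemb, integral_prod_symm _ hK', ← integral_neg]
  refine integral_congr_ae ?_
  filter_upwards [hG'.prod_left_ae, hK'.prod_left_ae,
    ae_restrict_mem (measurableSet_posOrthant k)] with w hGw hKw hw
  have := integral_Ioi_of_hasDerivAt_of_tendsto' (hderiv w hw) hKw
    (tendsto_zero_of_hasDerivAt_of_integrableOn_Ioi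
      (fun x hx => hderiv w hw x (le_of_lt hx)) hKw hGw)
  rw [this, zero_sub]

theorem dotProduct_insertNth (j : Fin (k + 1)) (a : Fin (k + 1) → ℝ) (x : ℝ) (w : Fin k → ℝ) :
    a ⬝ᵥ (j.insertNth x w : Fin (k + 1) → ℝ) = a j * x + (fun i => a (j.succAbove i)) ⬝ᵥ w := by
  simp [dotProduct, Fin.sum_univ_succAbove _ j]

variable {ι κ : Type*} [Fintype ι] [Fintype κ]

theorem posynomial_insertNth_zero (j : Fin (k + 1)) (c : κ → ℝ) (β : κ → Fin (k + 1) → ℝ)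
    (w : Fin k → ℝ) :
    posynomial c β (j.insertNth 0 w) = posynomial c (fun q i => β q (j.succAbove i)) w := by
  simp [posynomial, dotProduct_insertNth]

theorem eulerIntegrand_insertNth_zero (j : Fin (k + 1)) (c : ι → κ → ℝ)
    (β : ι → κ → Fin (k + 1) → ℝ) (a b : Fin (k + 1) → ℝ) (α γ : ι → ℝ) (s : ℂ)
    (w : Fin k → ℝ) :
    eulerIntegrand c β a b α γ s (j.insertNth 0 w) =
      eulerIntegrand c (fun i q i' => β i q (j.succAbove i')) (fun i => a (j.succAbove i))
        (fun i => b (j.succAbove i)) α γ s w := by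
  simp [eulerIntegrand, dotProduct_insertNth, posynomial_insertNth_zero]

theorem hasDerivAt_posynomial_insertNth (j : Fin (k + 1)) (c : κ → ℝ)
    (β : κ → Fin (k + 1) → ℝ) (w : Fin k → ℝ) (x : ℝ) :
    HasDerivAt (fun x => posynomial c β (j.insertNth x w))
      (-∑ q, c q * β q j * Real.exp (-(β q ⬝ᵥ (j.insertNth x w : Fin (k + 1) → ℝ)))) x := by
  unfold posynomial
  simp only [dotProduct_insertNth]
  rw [← Finset.sum_neg_distrib]
  refine HasDerivAt.fun_sum fun q _ => ?_
  have h := ((((hasDerivAt_id x).const_mul (β q j)).add_const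
    ((fun i => β q (j.succAbove i)) ⬝ᵥ w)).neg.exp).const_mul (c q)
  refine HasDerivAt.congr_deriv h ?_
  simp only [Pi.neg_apply, id_eq]
  ring

theorem eulerIntegrand_shift [DecidableEq ι] {k : ℕ} {c : ι → κ → ℝ} (hc : ∀ i q, 0 ≤ c i q)
    (hc' : ∀ i, ∃ q, 0 < c i q) (β : ι → κ → Fin k → ℝ) (a b δ : Fin k → ℝ) (α γ : ι → ℝ)
    (i : ι) (s : ℂ) (v : Fin k → ℝ) :
    eulerIntegrand c β (a + δ) b α (γ - Pi.single i 1) s v =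
      eulerIntegrand c β a b α γ s v *
        ((Real.exp (-(δ ⬝ᵥ v)) / posynomial (c i) (β i) v : ℝ) : ℂ) := by
  have hpos := posynomial_pos (hc i) (hc' i) (β i) v
  have h1 : Real.exp (-(δ ⬝ᵥ v)) / posynomial (c i) (β i) v =
      Real.exp (-(δ ⬝ᵥ v) - Real.log (posynomial (c i) (β i) v)) := by
    rw [Real.exp_sub, Real.exp_log hpos]
  rw [h1, Complex.ofReal_exp, eulerIntegrand, eulerIntegrand, ← Complex.exp_add]
  congr 1
  have h2 : ∑ i', (s * (α i' : ℂ) + (((γ - Pi.single i 1 : ι → ℝ) i' : ℝ) : ℂ)) *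
      ((Real.log (posynomial (c i') (β i') v) : ℝ) : ℂ) =
      ∑ i', (s * (α i' : ℂ) + (γ i' : ℂ)) *
        ((Real.log (posynomial (c i') (β i') v) : ℝ) : ℂ) -
      ((Real.log (posynomial (c i) (β i) v) : ℝ) : ℂ) := by
    rw [eq_sub_iff_add_eq, ← Finset.add_sum_erase _ _ (Finset.mem_univ i),
      ← Finset.add_sum_erase (a := i) _ _ (Finset.mem_univ i)]
    have : ∀ i' ∈ Finset.univ.erase i, (Pi.single i 1 : ι → ℝ) i' = 0 := fun i' hi' =>
      Pi.single_eq_of_ne (Finset.ne_of_mem_erase hi') 1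
    rw [Finset.sum_congr rfl (g := fun i' => (s * (α i' : ℂ) + (γ i' : ℂ)) *
        ((Real.log (posynomial (c i') (β i') v) : ℝ) : ℂ))
      fun i' hi' => by rw [Pi.sub_apply, this i' hi', sub_zero]]
    simp
    ring
  rw [h2, add_dotProduct]
  push_cast
  ring

theorem hasDerivAt_eulerIntegrand_insertNth [DecidableEq ι] (j : Fin (k + 1)) {c : ι → κ → ℝ}
    (hc : ∀ i q, 0 ≤ c i q) (hc' : ∀ i, ∃ q, 0 < c i q) (β : ι → κ → Fin (k + 1) → ℝ)
    (a b : Fin (k + 1) → ℝ) (α γ : ι → ℝ) (s : ℂ) (w : Fin k → ℝ) (x : ℝ) :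
    HasDerivAt (fun x => eulerIntegrand c β a b α γ s (j.insertNth x w))
      (-((a j + s * b j) * eulerIntegrand c β a b α γ s (j.insertNth x w)) -
        ∑ i, ∑ q, ((s * α i + γ i) * (c i q * β i q j)) *
          eulerIntegrand c β (a + β i q) b α (γ - Pi.single i 1) s (j.insertNth x w)) x := by
  set v : Fin (k + 1) → ℝ := j.insertNth x w with hv
  have hdot : ∀ y : Fin (k + 1) → ℝ,
      HasDerivAt (fun x : ℝ => ((y ⬝ᵥ (j.insertNth x w : Fin (k + 1) → ℝ) : ℝ) : ℂ))
        (y j : ℂ) x := fun y => by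
    simp only [dotProduct_insertNth]
    have h := ((hasDerivAt_id x).const_mul (y j)).add_const
      ((fun i => y (j.succAbove i)) ⬝ᵥ w)
    simpa using h.ofReal_comp
  have hlog : ∀ i, HasDerivAt
      (fun x : ℝ => ((Real.log (posynomial (c i) (β i) (j.insertNth x w)) : ℝ) : ℂ))
      (((-∑ q, c i q * β i q j * Real.exp (-(β i q ⬝ᵥ v))) / posynomial (c i) (β i) v : ℝ) : ℂ)
      x := fun i =>
    ((hasDerivAt_posynomial_insertNth j (c i) (β i) w x).log
      (posynomial_pos (hc i) (hc' i) _ _).ne').ofReal_comp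
  have hmain := (((hdot a).neg.sub ((hdot b).const_mul s)).add
    (HasDerivAt.fun_sum (u := Finset.univ) fun i _ =>
      (hlog i).const_mul (s * (α i : ℂ) + (γ i : ℂ)))).cexp
  refine HasDerivAt.congr_deriv (f := fun x => eulerIntegrand c β a b α γ s (j.insertNth x w))
    hmain ?_
  simp only [eulerIntegrand_shift hc hc']
  change eulerIntegrand c β a b α γ s v * _ = _
  have h3 : ∑ i, ∑ q, ((s * α i + γ i) * (c i q * β i q j)) * (eulerIntegrand c β a b α γ s v *
      ((Real.exp (-(β i q ⬝ᵥ v)) / posynomial (c i) (β i) v : ℝ) : ℂ)) =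
      eulerIntegrand c β a b α γ s v * ∑ i, (s * α i + γ i) *
        ((∑ q, c i q * β i q j * Real.exp (-(β i q ⬝ᵥ v)) / posynomial (c i) (β i) v : ℝ) : ℂ) := by
    rw [Finset.mul_sum]
    refine Finset.sum_congr rfl fun i _ => ?_
    rw [Complex.ofReal_sum, Finset.mul_sum, Finset.mul_sum]
    refine Finset.sum_congr rfl fun q _ => ?_
    push_cast
    ring
  rw [h3]
  simp only [neg_div, Finset.sum_div, Complex.ofReal_neg, mul_neg, Finset.sum_neg_distrib]
  ring

/-- Integration by parts in the direction `j`: the exponent `a j` can be raised at the cost of a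
lower dimensional boundary integral. -/
theorem mul_integral_eulerIntegrand [DecidableEq ι] (j : Fin (k + 1)) {c : ι → κ → ℝ}
    {β : ι → κ → Fin (k + 1) → ℝ} (h : IsMonomialized c β) {a b : Fin (k + 1) → ℝ}
    (α γ : ι → ℝ) {s : ℂ} (hs : ∀ j, 0 < a j + s.re * b j) :
    (a j + s * b j) * ∫ v in posOrthant (k + 1), eulerIntegrand c β a b α γ s v =
      (∫ w in posOrthant k, eulerIntegrand c (fun i q i' => β i q (j.succAbove i'))
        (fun i => a (j.succAbove i)) (fun i => b (j.succAbove i)) α γ s w) -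
      ∑ i, ∑ q, ((s * α i + γ i) * (c i q * β i q j)) * ∫ v in posOrthant (k + 1),
        eulerIntegrand c β (a + β i q) b α (γ - Pi.single i 1) s v := by
  have h_int := integrableOn_eulerIntegrand h α γ hs
  have h_int' : ∀ i q, IntegrableOn
      (eulerIntegrand c β (a + β i q) b α (γ - Pi.single i 1) s) (posOrthant (k + 1)) :=
    fun i q => integrableOn_eulerIntegrand h α _ fun j => by
      have := h.exponent_nonneg i q j
      rw [Pi.add_apply]
      linarith [hs j]
  have hsum : IntegrableOn (fun v => ∑ i, ∑ q, ((s * α i + γ i) * (c i q * β i q j)) *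
      eulerIntegrand c β (a + β i q) b α (γ - Pi.single i 1) s v) (posOrthant (k + 1)) :=
    integrable_finsetSum _ fun i _ => integrable_finsetSum _ fun q _ => (h_int' i q).const_mul _
  have hneg : IntegrableOn (fun v => -((a j + s * b j) * eulerIntegrand c β a b α γ s v))
      (posOrthant (k + 1)) := (h_int.const_mul (a j + s * b j)).neg
  have hibp := integral_posOrthant_deriv j h_int (hneg.sub hsum)
    fun w _ x _ => hasDerivAt_eulerIntegrand_insertNth j h.coeff_nonneg h.exists_coeff_pos
      β a b α γ s w x
  rw [integral_sub' hneg hsum, integral_neg,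
    integral_const_mul, integral_finsetSum _ fun i _ => integrable_finsetSum _ fun q _ =>
      (h_int' i q).const_mul _] at hibp
  simp only [integral_finsetSum _ fun q _ => (h_int' _ q).const_mul _, integral_const_mul,
    eulerIntegrand_insertNth_zero] at hibp
  linear_combination -hibp

end IntegrationByParts

section Orthant

theorem exists_pos_forall_le {X : Type*} [Finite X] (f : X → ℝ) :
    ∃ δ : ℝ, 0 < δ ∧ ∀ x, 0 < f x → δ ≤ f x := by
  rcases isEmpty_or_nonempty {x // 0 < f x} with h | h
  · exact ⟨1, one_pos, fun x hx => (h.false ⟨x, hx⟩).elim⟩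
  · obtain ⟨x, hx⟩ := Finite.exists_min fun x : {x // 0 < f x} => f x
    exact ⟨f x, x.2, fun y hy => hx ⟨y, hy⟩⟩

theorem nonneg_of_forall_add_mul_pos {a b : ℝ} (h : ∀ σ : ℝ, 0 < σ → 0 < a + σ * b) : 0 ≤ b := by
  by_contra! hb
  have h1 := h ((|a| + 1) / -b) (div_pos (by positivity) (by linarith))
  have h2 : (|a| + 1) / -b * b = -(|a| + 1) := by
    rw [div_neg, neg_mul, div_mul_cancel₀ _ hb.ne]
  have h3 := le_abs_self a
  linarith

variable {ι κ : Type*} [Fintype ι] [Fintype κ]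

theorem IsMonomialized.hasContinuation (M : ℝ) {k : ℕ} {c : ι → κ → ℝ} {β : ι → κ → Fin k → ℝ}
    (h : IsMonomialized c β) {a b : Fin k → ℝ} (α γ : ι → ℝ)
    (hab : ∀ σ : ℝ, 0 < σ → ∀ j, 0 < a j + σ * b j) :
    HasContinuation M fun s => ∫ v in posOrthant k, eulerIntegrand c β a b α γ s v := by
  classical
  induction k generalizing γ with
  | zero =>
    have := differentiableOn_integral_eulerIntegrand h α γ (M := M) (a := a) (b := b)
      (fun j => j.elim0) fun j => j.elim0
    exact ⟨_, (this.analyticOnNhd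
      (isOpen_lt continuous_const Complex.continuous_re)).meromorphicOn, fun _ _ => rfl⟩
  | succ k ihk =>
    obtain ⟨δ, hδ, hβδ⟩ := exists_pos_forall_le
      fun x : ι × κ × Fin (k + 1) => β x.1 x.2.1 x.2.2
    induction hν : ∑ j, ⌊(M * b j - a j) / δ + 1⌋₊ using Nat.strong_induction_on
      generalizing a γ with
    | _ ν ihν =>
    subst hν
    have hb : ∀ j, 0 ≤ b j := fun j => nonneg_of_forall_add_mul_pos fun σ hσ => hab σ hσ j
    by_cases hM : ∀ j, 0 < a j - M * b j
    · exact ⟨_, ((differentiableOn_integral_eulerIntegrand h α γ hb hM).analyticOnNhd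
        (isOpen_lt continuous_const Complex.continuous_re)).meromorphicOn, fun _ _ => rfl⟩
    push Not at hM
    obtain ⟨j, hj⟩ := hM
    have hface : HasContinuation M fun s => ∫ w in posOrthant k,
        eulerIntegrand c (fun i q i' => β i q (j.succAbove i')) (fun i => a (j.succAbove i))
          (fun i => b (j.succAbove i)) α γ s w := by
      refine ihk ⟨h.coeff_nonneg, fun i q _ => h.exponent_nonneg i q _, fun i => ?_⟩ _
        fun σ hσ _ => hab σ hσ _
      obtain ⟨q, hq, hβ⟩ := h.exists_const i
      exact ⟨q, hq, by ext; simp [hβ]⟩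
    have hterm : ∀ i q, HasContinuation M fun s => -((s * α i + γ i) * (c i q * β i q j)) *
        ∫ v in posOrthant (k + 1),
          eulerIntegrand c β (a + β i q) b α (γ - Pi.single i 1) s v := fun i q => by
      rcases (h.exponent_nonneg i q j).eq_or_lt with hβ | hβ
      · exact HasContinuation.zero.congr fun s _ => by simp [← hβ]
      refine (ihν _ ?_ _ (fun σ hσ j' => ?_) rfl).mul_meromorphic fun s => ?_
      · refine Finset.sum_lt_sum (fun j' _ => Nat.floor_le_floor ?_) ⟨j, Finset.mem_univ j, ?_⟩
        · have := h.exponent_nonneg i q j'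
          rw [Pi.add_apply]
          gcongr
          linarith
        · have h1 : β i q j ≥ δ := hβδ (i, q, j) hβ
          have h2 : 0 ≤ (M * b j - a j) / δ := div_nonneg (by linarith) hδ.le
          rw [Nat.floor_add_one h2, Nat.lt_succ_iff]
          refine Nat.floor_le_floor ?_
          rw [Pi.add_apply, div_add_one hδ.ne']
          gcongr
          linarith
      · have := h.exponent_nonneg i q j'
        rw [Pi.add_apply]
        linarith [hab σ hσ j']
      · exact AnalyticAt.meromorphicAt (by fun_prop)
    refine ((hface.add (HasContinuation.sum Finset.univ fun i _ =>
      HasContinuation.sum Finset.univ fun q _ => hterm i q)).mul_meromorphic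
      (h := fun s => ((a j : ℂ) + s * b j)⁻¹) fun s => ?_).congr fun s hs => ?_
    · exact (AnalyticAt.meromorphicAt (by fun_prop)).inv
    · have hne : (a j : ℂ) + s * b j ≠ 0 := fun h0 => by
        have := congrArg Complex.re h0
        simp at this
        linarith [hab s.re hs j]
      rw [inv_mul_eq_iff_eq_mul₀ hne,
        mul_integral_eulerIntegrand j h α γ fun j => hab s.re hs j]
      simp only [neg_mul, Finset.sum_neg_distrib]
      ring

end Orthant

section Subdivision

variable {k : ℕ}

theorem vecMul_transvection (w : Fin k → ℝ) (i j : Fin k) (x : ℝ) :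
    w ᵥ* transvection i j x = w + Pi.single j (w i * x) := by
  rw [transvection, vecMul_add, vecMul_one, ← mulVec_transpose, transpose_single, single_mulVec,
    mul_comm]
  rfl

theorem transvection_mulVec (v : Fin k → ℝ) (i j : Fin k) (x : ℝ) :
    transvection i j x *ᵥ v = v + Pi.single i (x * v j) := by
  rw [transvection, add_mulVec, one_mulVec, single_mulVec]
  rfl

/-- By repeatedly cutting orthants along hyperplanes `v i = x * v j`, finitely many linear
forms become definite on each of the pieces. -/
theorem forall_matrix_of_transvection (Λ : Finset (Fin k → ℝ))
    {P : Matrix (Fin k) (Fin k) ℝ → Prop}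
    (hsplit : ∀ T i j (x : ℝ), i ≠ j → 0 < x → P (T * transvection i j x) →
      P (T * transvection j i x⁻¹) → P T)
    (hdef : ∀ T, (∀ w ∈ Λ, 0 ≤ w ᵥ* T ∨ w ᵥ* T ≤ 0) → P T) (T : Matrix (Fin k) (Fin k) ℝ) :
    P T := by
  classical
  induction Λ using Finset.induction_on generalizing T with
  | empty => exact hdef T (by simp)
  | insert μ Λ hμ ih =>
    refine ih (fun T hT => ?_) T
    induction hν : #{i | (μ ᵥ* T) i ≠ 0} using Nat.strong_induction_on generalizing T with
    | _ ν ihν =>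
    subst hν
    by_cases hμT : 0 ≤ μ ᵥ* T ∨ μ ᵥ* T ≤ 0
    · exact hdef T (by simpa using ⟨hμT, hT⟩)
    simp only [not_or, Pi.le_def, Pi.zero_apply, not_forall, not_le] at hμT
    obtain ⟨⟨j, hj⟩, ⟨i, hi⟩⟩ := hμT
    have hij : i ≠ j := fun h => by
      subst h
      exact lt_asymm hi hj
    have hkey : ∀ (i j : Fin k) (x : ℝ), 0 < x → (μ ᵥ* T) j ≠ 0 →
        (μ ᵥ* T) j + (μ ᵥ* T) i * x = 0 → P (T * transvection i j x) := by
      intro i j x hx hj0 hzero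
      refine ihν _ ?_ _ (fun w hw => ?_) rfl
      · refine Finset.card_lt_card (Finset.ssubset_iff_of_subset ?_ |>.2 ⟨j, ?_, ?_⟩)
        · intro i' hi'
          simp only [← vecMul_vecMul, vecMul_transvection, Finset.mem_filter_univ,
            Pi.add_apply] at hi' ⊢
          rcases eq_or_ne i' j with rfl | h
          · exact hj0
          · simpa [h] using hi'
        · simpa using hj0
        · simpa [← vecMul_vecMul, vecMul_transvection] using hzero
      · simp only [← vecMul_vecMul, vecMul_transvection]
        refine (hT w hw).imp (fun h => add_nonneg h ?_) fun h => add_nonpos h ?_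
        · exact Pi.single_nonneg.2 (mul_nonneg (h i) hx.le)
        · exact Pi.single_nonpos.2 (mul_nonpos_of_nonpos_of_nonneg (h i) hx.le)
    refine hsplit T i j (-(μ ᵥ* T) j / (μ ᵥ* T) i) hij (div_pos (neg_pos.2 hj) hi)
      (hkey i j _ (div_pos (neg_pos.2 hj) hi) hj.ne ?_)
      (hkey j i _ (inv_pos.2 (div_pos (neg_pos.2 hj) hi)) hi.ne' ?_)
    · rw [mul_div_cancel₀ _ hi.ne', add_neg_cancel]
    · rw [inv_div, div_neg, mul_neg, mul_div_cancel₀ _ hj.ne, add_neg_cancel]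

theorem measurePreserving_transvection {i j : Fin k} (hij : i ≠ j) (x : ℝ) :
    MeasurePreserving (fun v : Fin k → ℝ => transvection i j x *ᵥ v) :=
  Real.volume_preserving_transvectionStruct ⟨i, j, hij, x⟩

theorem measurableEmbedding_transvection {i j : Fin k} (hij : i ≠ j) (x : ℝ) :
    MeasurableEmbedding (fun v : Fin k → ℝ => transvection i j x *ᵥ v) := by
  have hc : ∀ y : ℝ, Measurable (fun v : Fin k → ℝ => transvection i j y *ᵥ v) := fun y =>
    (measurePreserving_transvection hij y).measurable
  refine MeasurableEquiv.measurableEmbedding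
    ⟨⟨fun v => transvection i j x *ᵥ v, fun v => transvection i j (-x) *ᵥ v, fun v => ?_,
      fun v => ?_⟩, hc x, hc (-x)⟩
  · simp [mulVec_mulVec, transvection_mul_transvection_same _ _ hij]
  · simp [mulVec_mulVec, transvection_mul_transvection_same _ _ hij]

theorem preimage_transvection_posOrthant {i j : Fin k} (hij : i ≠ j) {x : ℝ} (hx : 0 < x) :
    (fun v : Fin k → ℝ => transvection i j x *ᵥ v) ⁻¹'
      (posOrthant k ∩ {v | x * v j < v i}) = posOrthant k := by
  ext v
  simp only [transvection_mulVec, posOrthant, Set.mem_preimage, Set.mem_inter_iff,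
    Set.mem_ofPred_eq, Pi.add_apply, Pi.single_eq_same, Pi.single_eq_of_ne hij.symm, add_zero,
    lt_add_iff_pos_left]
  refine ⟨fun h i' => ?_, fun h => ⟨fun i' => add_pos_of_pos_of_nonneg (h i') ?_, h i⟩⟩
  · rcases eq_or_ne i' i with rfl | hi
    · exact h.2
    · simpa [hi] using h.1 i'
  · rw [Pi.single_apply]
    split_ifs
    exacts [(mul_pos hx (h j)).le, le_rfl]

theorem volume_setOf_eq_mul {i j : Fin k} (hij : i ≠ j) (x : ℝ) :
    volume {v : Fin k → ℝ | v i = x * v j} = 0 := by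
  let f : (Fin k → ℝ) →ₗ[ℝ] ℝ := LinearMap.proj i - x • LinearMap.proj j
  have h := Measure.addHaar_submodule (volume : Measure (Fin k → ℝ)) (LinearMap.ker f) fun h => by
    have := LinearMap.congr_fun (LinearMap.ker_eq_top.1 h) (Pi.single i 1)
    simp [f, hij.symm] at this
  convert h using 2
  ext v
  simp [f, sub_eq_zero]

theorem setIntegral_posOrthant_split {i j : Fin k} (hij : i ≠ j) {x : ℝ} (hx : 0 < x)
    {g : (Fin k → ℝ) → ℂ} (hg : IntegrableOn g (posOrthant k)) :
    IntegrableOn (fun v => g (transvection i j x *ᵥ v)) (posOrthant k) ∧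
    IntegrableOn (fun v => g (transvection j i x⁻¹ *ᵥ v)) (posOrthant k) ∧
    ∫ v in posOrthant k, g v = (∫ v in posOrthant k, g (transvection i j x *ᵥ v)) +
      ∫ v in posOrthant k, g (transvection j i x⁻¹ *ᵥ v) := by
  have hx' := inv_pos.2 hx
  have h1 := (measurePreserving_transvection hij x).integrableOn_comp_preimage
    (measurableEmbedding_transvection hij x) (f := g) (s := posOrthant k ∩ {v | x * v j < v i})
  have h2 := (measurePreserving_transvection hij.symm x⁻¹).integrableOn_comp_preimage
    (measurableEmbedding_transvection hij.symm x⁻¹) (f := g)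
    (s := posOrthant k ∩ {v | x⁻¹ * v i < v j})
  have e1 := (measurePreserving_transvection hij x).setIntegral_preimage_emb
    (measurableEmbedding_transvection hij x) g (posOrthant k ∩ {v | x * v j < v i})
  have e2 := (measurePreserving_transvection hij.symm x⁻¹).setIntegral_preimage_emb
    (measurableEmbedding_transvection hij.symm x⁻¹) g
    (posOrthant k ∩ {v | x⁻¹ * v i < v j})
  rw [preimage_transvection_posOrthant hij hx] at h1 e1
  rw [preimage_transvection_posOrthant hij.symm hx'] at h2 e2
  refine ⟨h1.2 (hg.mono_set Set.inter_subset_left), h2.2 (hg.mono_set Set.inter_subset_left), ?_⟩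
  rw [e1, e2, ← setIntegral_union]
  · refine setIntegral_congr_set ?_
    rw [ae_eq_set]
    refine ⟨measure_mono_null (fun v hv => ?_) (volume_setOf_eq_mul hij x), ?_⟩
    · by_contra hne
      refine hv.2 ?_
      rcases lt_or_gt_of_ne hne with h | h
      · exact Or.inr ⟨hv.1, (inv_mul_lt_iff₀ hx).2 h⟩
      · exact Or.inl ⟨hv.1, h⟩
    · rw [← Set.inter_union_distrib_left, Set.sdiff_eq_empty.2 Set.inter_subset_left, measure_empty]
  · rw [Set.disjoint_left]
    rintro v ⟨-, h⟩ ⟨-, h'⟩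
    exact lt_asymm h ((inv_mul_lt_iff₀ hx).1 h')
  · refine (measurableSet_posOrthant k).inter (measurableSet_lt ?_ ?_) <;> fun_prop
  · exact hg.mono_set Set.inter_subset_left
  · exact hg.mono_set Set.inter_subset_left

end Subdivision

section Definite

theorem pos_of_integrableOn_exp_neg_dotProduct {k : ℕ} {x : Fin k → ℝ}
    (hx : IntegrableOn (fun v => Real.exp (-(x ⬝ᵥ v))) (posOrthant k)) (j : Fin k) :
    0 < x j := by
  obtain _ | k := k
  · exact j.elim0
  have h : Integrable (fun p : ℝ × (Fin k → ℝ) =>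
      Real.exp (-(x ⬝ᵥ (j.insertNth p.1 p.2 : Fin (k + 1) → ℝ))))
      ((volume.restrict (Set.Ioi 0)).prod (volume.restrict (posOrthant k))) :=
    ((measurePreserving_insertNth_posOrthant j).integrable_comp_emb
      (measurableEmbedding_insertNth j)).2 hx
  have hopen : IsOpen (posOrthant k) := by
    rw [posOrthant_eq_pi]
    exact isOpen_set_pi Set.finite_univ fun _ _ => isOpen_Ioi
  have hne : (ae (volume.restrict (posOrthant k))).NeBot := by
    rw [ae_neBot, Ne, Measure.restrict_eq_zero]
    exact (hopen.measure_pos _ ⟨fun _ => 1, fun _ => one_pos⟩).ne'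
  obtain ⟨w, hw⟩ := h.prod_left_ae.exists
  by_contra! hxj
  have hc : IntegrableOn (fun _ : ℝ => Real.exp (-((fun i => x (j.succAbove i)) ⬝ᵥ w)))
      (Set.Ioi 0) := by
    refine Integrable.mono hw aestronglyMeasurable_const ?_
    filter_upwards [ae_restrict_mem measurableSet_Ioi] with y hy
    rw [dotProduct_insertNth, Real.norm_eq_abs, Real.norm_eq_abs, Real.abs_exp, Real.abs_exp,
      Real.exp_le_exp]
    have := mul_nonpos_of_nonpos_of_nonneg hxj (le_of_lt hy)
    linarith
  rw [integrableOn_const_iff] at hc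
  simp at hc

variable {k : ℕ} {ι κ : Type*} [Fintype ι] [Fintype κ]

theorem IsMonomialized.pos_of_integrableOn {c : ι → κ → ℝ} {β : ι → κ → Fin k → ℝ}
    (h : IsMonomialized c β) {a b : Fin k → ℝ} {α γ : ι → ℝ} {s : ℂ}
    (h_int : IntegrableOn (eulerIntegrand c β a b α γ s) (posOrthant k)) (j : Fin k) :
    0 < a j + s.re * b j := by
  obtain ⟨Λ, -, hΛ⟩ := h.exists_abs_log_le
  refine pos_of_integrableOn_exp_neg_dotProduct (x := a + s.re • b) ?_ j
  refine Integrable.mono' (h_int.norm.mul_const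
    (Real.exp (∑ i, |s.re * α i + γ i| * Λ))) ?_ ?_
  · have : Continuous fun v : Fin k → ℝ => Real.exp (-((a + s.re • b) ⬝ᵥ v)) := by
      unfold dotProduct
      fun_prop
    exact this.aestronglyMeasurable
  · filter_upwards [ae_restrict_mem (measurableSet_posOrthant k)] with v hv
    rw [norm_eulerIntegrand, mul_assoc, ← Real.exp_add, Real.norm_eq_abs, Real.abs_exp]
    refine le_mul_of_one_le_right (Real.exp_nonneg _) (Real.one_le_exp ?_)
    rw [← Finset.sum_add_distrib]
    refine Finset.sum_nonneg fun i _ => ?_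
    have h1 := mul_le_mul_of_nonneg_left (hΛ i v fun j => (hv j).le)
      (abs_nonneg (s.re * α i + γ i))
    rw [← abs_mul] at h1
    linarith [neg_abs_le ((s.re * α i + γ i) * Real.log (posynomial (c i) (β i) v))]

theorem hasContinuation_of_definite (M : ℝ) {c : ι → κ → ℝ} (hc : ∀ i q, 0 ≤ c i q)
    (hc' : ∀ i, ∃ q, 0 < c i q) {β : ι → κ → Fin k → ℝ}
    (hβ : ∀ i q q', β i q ≤ β i q' ∨ β i q' ≤ β i q) (a b : Fin k → ℝ) (α γ : ι → ℝ)
    (h_int : ∀ s : ℂ, 0 < s.re → IntegrableOn (eulerIntegrand c β a b α γ s) (posOrthant k)) :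
    HasContinuation M fun s => ∫ v in posOrthant k, eulerIntegrand c β a b α γ s v := by
  classical
  have hmin : ∀ i, ∃ q, 0 < c i q ∧ ∀ q', 0 < c i q' → β i q ≤ β i q' := fun i => by
    obtain ⟨q, hq, hq'⟩ := Set.Finite.exists_minimalFor (β i) {q | 0 < c i q}
      (Set.toFinite _) (hc' i)
    exact ⟨q, hq, fun q' hq'' => (hβ i q q').elim id fun h => hq' hq'' h⟩
  choose q₀ hq₀ hq₀' using hmin
  let β' : ι → κ → Fin k → ℝ := fun i q => if c i q = 0 then 0 else β i q - β i (q₀ i)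
  have hmono : IsMonomialized c β' := by
    refine ⟨hc, fun i q j => ?_, fun i => ⟨q₀ i, hq₀ i, ?_⟩⟩
    · by_cases h0 : c i q = 0
      · simp [β', h0]
      · simpa [β', h0] using hq₀' i q ((hc i q).lt_of_ne' h0) j
    · simp [β']
  have hpos : ∀ i v, posynomial (c i) (β i) v =
      Real.exp (-(β i (q₀ i) ⬝ᵥ v)) * posynomial (c i) (β' i) v := fun i v => by
    rw [posynomial, posynomial, Finset.mul_sum]
    refine Finset.sum_congr rfl fun q _ => ?_
    by_cases h0 : c i q = 0
    · simp [h0]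
    · rw [mul_left_comm, ← Real.exp_add]
      simp [β', h0, sub_dotProduct]
      ring
  have heq : ∀ s v, eulerIntegrand c β a b α γ s v = eulerIntegrand c β'
      (a + ∑ i, γ i • β i (q₀ i)) (b + ∑ i, α i • β i (q₀ i)) α γ s v := fun s v => by
    have hlog : ∀ i, Real.log (posynomial (c i) (β i) v) =
        -(β i (q₀ i) ⬝ᵥ v) + Real.log (posynomial (c i) (β' i) v) := fun i => by
      rw [hpos, Real.log_mul (Real.exp_pos _).ne'
        (posynomial_pos (hc i) (hc' i) _ _).ne', Real.log_exp]
    rw [eulerIntegrand, eulerIntegrand]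
    congr 1
    simp only [hlog, add_dotProduct, sum_dotProduct, smul_dotProduct, smul_eq_mul]
    push_cast
    simp only [mul_add, add_mul, Finset.sum_add_distrib, Finset.mul_sum, mul_neg,
      Finset.sum_neg_distrib]
    ring_nf
  have heq' : ∀ s, eulerIntegrand c β a b α γ s = _ := fun s => funext (heq s)
  simp only [heq'] at h_int ⊢
  refine hmono.hasContinuation M α γ fun σ hσ j => ?_
  simpa using hmono.pos_of_integrableOn (h_int σ (by simpa using hσ)) j

theorem eulerIntegrand_mulVec (c : ι → κ → ℝ) (β : ι → κ → Fin k → ℝ) (a b : Fin k → ℝ)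
    (α γ : ι → ℝ) (s : ℂ) (T : Matrix (Fin k) (Fin k) ℝ) (v : Fin k → ℝ) :
    eulerIntegrand c β a b α γ s (T *ᵥ v) =
      eulerIntegrand c (fun i q => β i q ᵥ* T) (a ᵥ* T) (b ᵥ* T) α γ s v := by
  simp only [eulerIntegrand, posynomial, dotProduct_mulVec]

theorem hasContinuation_posOrthant (M : ℝ) {c : ι → κ → ℝ} (hc : ∀ i q, 0 ≤ c i q)
    (hc' : ∀ i, ∃ q, 0 < c i q) (β : ι → κ → Fin k → ℝ) (a b : Fin k → ℝ) (α γ : ι → ℝ)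
    (T : Matrix (Fin k) (Fin k) ℝ)
    (h_int : ∀ s : ℂ, 0 < s.re →
      IntegrableOn (fun v => eulerIntegrand c β a b α γ s (T *ᵥ v)) (posOrthant k)) :
    HasContinuation M fun s => ∫ v in posOrthant k, eulerIntegrand c β a b α γ s (T *ᵥ v) := by
  classical
  revert h_int
  refine forall_matrix_of_transvection (P := fun T => (∀ s : ℂ, 0 < s.re →
      IntegrableOn (fun v => eulerIntegrand c β a b α γ s (T *ᵥ v)) (posOrthant k)) →
    HasContinuation M fun s => ∫ v in posOrthant k, eulerIntegrand c β a b α γ s (T *ᵥ v))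
    (Finset.univ.image fun x : ι × κ × κ => β x.1 x.2.1 - β x.1 x.2.2) ?_ ?_ T
  · intro T i j x hij hx h1 h2 h_int
    have hs := fun s hs => setIntegral_posOrthant_split hij hx (h_int s hs)
    simp only [mulVec_mulVec] at hs
    exact ((h1 fun s hs' => (hs s hs').1).add (h2 fun s hs' => (hs s hs').2.1)).congr
      fun s hs' => (hs s hs').2.2.symm
  · intro T hT h_int
    simp only [eulerIntegrand_mulVec] at h_int ⊢
    refine hasContinuation_of_definite M hc hc' (fun i q q' => ?_) _ _ α γ h_int
    have := hT _ (Finset.mem_image_of_mem _ (Finset.mem_univ (i, q', q)))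
    simpa only [sub_vecMul, sub_nonneg, sub_nonpos] using this

theorem measurePreserving_diagonal_mulVec {d : Fin k → ℝ} (hd : ∀ i, |d i| = 1) :
    MeasurePreserving (fun v : Fin k → ℝ => diagonal d *ᵥ v) := by
  have hdet : |(diagonal d).det| = 1 := by
    rw [det_diagonal, Finset.abs_prod]
    exact Finset.prod_eq_one fun i _ => hd i
  refine ⟨(Continuous.matrix_mulVec continuous_const continuous_id).measurable, ?_⟩
  have h := Real.map_matrix_volume_pi_eq_smul_volume_pi (M := diagonal d) fun h0 => by
    rw [h0, abs_zero] at hdet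
    exact zero_ne_one hdet
  rw [abs_inv, hdet, inv_one, ENNReal.ofReal_one, one_smul] at h
  exact h

theorem measurableEmbedding_diagonal_mulVec {d : Fin k → ℝ} (hd : ∀ i, |d i| = 1) :
    MeasurableEmbedding (fun v : Fin k → ℝ => diagonal d *ᵥ v) := by
  have hinv : ∀ v, diagonal d *ᵥ (diagonal d *ᵥ v) = v := fun v => by
    ext i
    rw [mulVec_diagonal, mulVec_diagonal, ← mul_assoc, ← abs_mul_abs_self, hd, one_mul, one_mul]
  have hm := (measurePreserving_diagonal_mulVec hd).measurable
  exact MeasurableEquiv.measurableEmbedding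
    ⟨⟨fun v => diagonal d *ᵥ v, fun v => diagonal d *ᵥ v, hinv, hinv⟩, hm, hm⟩

/-- The integral over the whole space is a finite sum of integrals over orthants. -/
theorem integral_eq_sum_posOrthant {g : (Fin k → ℝ) → ℂ} (hg : Integrable g) :
    ∫ v, g v = ∑ ε : Fin k → Bool,
      ∫ v in posOrthant k, g (diagonal (fun i => if ε i then 1 else -1) *ᵥ v) := by
  let d : (Fin k → Bool) → Fin k → ℝ := fun ε i => if ε i then 1 else -1
  have hd : ∀ ε i, |d ε i| = 1 := fun ε i => by
    by_cases h : ε i <;> simp [d, h]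
  let A : (Fin k → Bool) → Set (Fin k → ℝ) := fun ε => {v | ∀ i, 0 < d ε i * v i}
  have hA : ∀ ε, (fun v : Fin k → ℝ => diagonal (d ε) *ᵥ v) ⁻¹' A ε = posOrthant k := fun ε => by
    ext v
    refine forall_congr' fun i => ?_
    change 0 < d ε i * (diagonal (d ε) *ᵥ v) i ↔ 0 < v i
    rw [mulVec_diagonal, ← mul_assoc, ← abs_mul_abs_self, hd, one_mul, one_mul]
  have h1 : ∀ ε, ∫ v in A ε, g v = ∫ v in posOrthant k, g (diagonal (d ε) *ᵥ v) := fun ε => by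
    rw [← hA ε]
    exact ((measurePreserving_diagonal_mulVec (hd ε)).setIntegral_preimage_emb
      (measurableEmbedding_diagonal_mulVec (hd ε)) g (A ε)).symm
  simp only [← h1, d]
  rw [← integral_iUnion_fintype, ← setIntegral_univ]
  · refine setIntegral_congr_set ?_
    have hne : ∀ᵐ v : Fin k → ℝ, ∀ i, v i ≠ 0 :=
      ae_all_iff.2 fun i =>
        ae_iff.2 (by simpa [volume_pi] using Measure.pi_hyperplane (fun _ => volume) i 0)
    filter_upwards [hne] with v hv
    refine propext ⟨fun _ => Set.mem_iUnion.2 ⟨fun i => decide (0 < v i), fun i => ?_⟩,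
      fun _ => Set.mem_univ v⟩
    rcases lt_or_gt_of_ne (hv i) with h | h
    · simp [d, h.not_gt, h]
    · simp [d, h]
  · intro ε
    have : A ε = ⋂ i, {v | 0 < d ε i * v i} := by
      ext
      simp [A]
    rw [this]
    exact MeasurableSet.iInter fun i => measurableSet_lt measurable_const (by fun_prop)
  · intro ε ε' hε
    rw [Function.onFun, Set.disjoint_left]
    intro v hv hv'
    refine hε (funext fun i => ?_)
    have h1 := hv i
    have h2 := hv' i
    by_cases h : ε i <;> by_cases h' : ε' i <;> simp [d, h, h'] at h1 h2 ⊢ <;> linarith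
  · exact fun ε => hg.integrableOn

theorem hasContinuation_integral (M : ℝ) {c : ι → κ → ℝ} (hc : ∀ i q, 0 ≤ c i q)
    (hc' : ∀ i, ∃ q, 0 < c i q) (β : ι → κ → Fin k → ℝ) (a b : Fin k → ℝ) (α γ : ι → ℝ)
    (h_int : ∀ s : ℂ, 0 < s.re → Integrable (eulerIntegrand c β a b α γ s)) :
    HasContinuation M fun s => ∫ v, eulerIntegrand c β a b α γ s v := by
  have hd : ∀ (ε : Fin k → Bool) i, |(if ε i then 1 else -1 : ℝ)| = 1 := fun ε i => by
    by_cases h : ε i <;> simp [h]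
  have h : ∀ ε : Fin k → Bool, HasContinuation M fun s => ∫ v in posOrthant k,
      eulerIntegrand c β a b α γ s (diagonal (fun i => if ε i then 1 else -1) *ᵥ v) :=
    fun ε => hasContinuation_posOrthant M hc hc' β a b α γ _ fun s hs =>
      (((measurePreserving_diagonal_mulVec (hd ε)).integrable_comp_emb
        (measurableEmbedding_diagonal_mulVec (hd ε))
        (g := eulerIntegrand c β a b α γ s)).2 (h_int s hs)).integrableOn
  exact (HasContinuation.sum Finset.univ fun ε _ => h ε).congr
    fun s hs => (integral_eq_sum_posOrthant (h_int s hs)).symm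

end Definite

/-- The function is given on the positive orthant by a homogeneous generalized polynomial of
degree `N` with nonnegative coefficients. -/
def IsHomPosynomial {k : ℕ} (N : ℕ) (g : (Fin k → ℝ) → ℝ) : Prop :=
  ∃ (κ : Type) (_ : Fintype κ) (c : κ → ℝ) (e : κ → Fin k → ℝ), (∀ q, 0 ≤ c q) ∧
    (∀ q, ∑ j, e q j = N) ∧ ∀ u, g (fun j => Real.exp (-u j)) = posynomial c e u

namespace IsHomPosynomial

variable {k N N' : ℕ} {g h : (Fin k → ℝ) → ℝ}

theorem zero : IsHomPosynomial (k := k) N fun _ => 0 :=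
  ⟨Empty, inferInstance, Empty.elim, fun q => q.elim, fun q => q.elim, fun q => q.elim,
    fun u => by simp [posynomial]⟩

theorem const {x : ℝ} (hx : 0 ≤ x) : IsHomPosynomial (k := k) 0 fun _ => x :=
  ⟨Unit, inferInstance, fun _ => x, fun _ => 0, fun _ => hx, fun _ => by simp,
    fun u => by simp [posynomial]⟩

theorem apply (j : Fin k) : IsHomPosynomial 1 fun t : Fin k → ℝ => t j :=
  ⟨Unit, inferInstance, fun _ => 1, fun _ => Pi.single j 1, fun _ => zero_le_one,
    fun _ => by simp, fun u => by simp [posynomial]⟩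

theorem add (hg : IsHomPosynomial N g) (hh : IsHomPosynomial N h) :
    IsHomPosynomial N fun t => g t + h t := by
  obtain ⟨κ, _, c, e, hc, he, hg⟩ := hg
  obtain ⟨κ', _, c', e', hc', he', hh⟩ := hh
  refine ⟨κ ⊕ κ', inferInstance, Sum.elim c c', Sum.elim e e', ?_, ?_, fun u => ?_⟩
  · rintro (q | q)
    exacts [hc q, hc' q]
  · rintro (q | q)
    exacts [he q, he' q]
  · simp [hg, hh, posynomial]

theorem mul (hg : IsHomPosynomial N g) (hh : IsHomPosynomial N' h) :
    IsHomPosynomial (N + N') fun t => g t * h t := by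
  obtain ⟨κ, _, c, e, hc, he, hg⟩ := hg
  obtain ⟨κ', _, c', e', hc', he', hh⟩ := hh
  refine ⟨κ × κ', inferInstance, fun q => c q.1 * c' q.2, fun q => e q.1 + e' q.2,
    fun q => mul_nonneg (hc _) (hc' _), fun q => ?_, fun u => ?_⟩
  · simp [Finset.sum_add_distrib, he, he']
  · simp only [hg, hh, posynomial, Finset.sum_mul_sum, Fintype.sum_prod_type, add_dotProduct,
      neg_add, Real.exp_add, mul_mul_mul_comm]

theorem const_mul {x : ℝ} (hx : 0 ≤ x) (hg : IsHomPosynomial N g) :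
    IsHomPosynomial N fun t => x * g t := by
  simpa using (const hx).mul hg

theorem sum {J : Type*} (S : Finset J) {g : J → (Fin k → ℝ) → ℝ}
    (hg : ∀ j ∈ S, IsHomPosynomial N (g j)) : IsHomPosynomial N fun t => ∑ j ∈ S, g j t := by
  classical
  induction S using Finset.induction_on with
  | empty => simpa using zero
  | insert j S hj ih =>
    simp only [Finset.sum_insert hj]
    exact (hg j (Finset.mem_insert_self j S)).add
      (ih fun i hi => hg i (Finset.mem_insert_of_mem hi))

theorem prod_apply {J : Type*} (S : Finset J) (f : J → Fin k) :
    IsHomPosynomial #S fun t => ∏ x ∈ S, t (f x) := by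
  classical
  induction S using Finset.induction_on with
  | empty => simpa using const zero_le_one
  | insert j S hj ih =>
    simp only [Finset.prod_insert hj, Finset.card_insert_of_notMem hj]
    rw [add_comm]
    exact (apply _).mul ih

end IsHomPosynomial

section Determinant

theorem factorial_mul_det_sum_smul_vecMulVec {d Q R : Type*} [Fintype d] [DecidableEq d]
    [Fintype Q] [CommRing R] (w : Q → R) (r : Q → d → R) :
    ((Fintype.card d).factorial : R) * (∑ q, w q • vecMulVec (r q) (r q)).det =
      ∑ f : d → Q, (∏ x, w (f x)) * (Matrix.of fun x => r (f x)).det ^ 2 := by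
  classical
  have h1 : (∑ q, w q • vecMulVec (r q) (r q)).det =
      ∑ f : d → Q, (∏ x, w (f x)) * ((∏ x, r (f x) x) * (Matrix.of fun x => r (f x)).det) := by
    have : (∑ q, w q • vecMulVec (r q) (r q)) = fun x => ∑ q, (w q * r q x) • r q := by
      ext x y
      simp [Matrix.sum_apply, vecMulVec_apply, mul_assoc]
    rw [this]
    change detRowAlternating.toMultilinearMap (fun x => ∑ q, (w q * r q x) • r q) = _
    rw [MultilinearMap.map_sum]
    refine Finset.sum_congr rfl fun f _ => ?_
    rw [MultilinearMap.map_smul_univ, Finset.prod_mul_distrib, smul_eq_mul, mul_assoc]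
    rfl
  have h2 : ∀ σ : Equiv.Perm d, (∑ q, w q • vecMulVec (r q) (r q)).det =
      ∑ f : d → Q, (∏ x, w (f x)) * (((Equiv.Perm.sign σ : ℤ) : R) * (∏ x, r (f (σ x)) x) *
        (Matrix.of fun x => r (f x)).det) := fun σ => by
    rw [h1, ← (Equiv.arrowCongr σ.symm (Equiv.refl Q)).sum_comp]
    refine Finset.sum_congr rfl fun f _ => ?_
    have e1 : Equiv.arrowCongr σ.symm (Equiv.refl Q) f = fun x => f (σ x) := rfl
    have e2 : (Matrix.of fun x => r (f (σ x))).det =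
        ((Equiv.Perm.sign σ : ℤ) : R) * (Matrix.of fun x => r (f x)).det :=
      det_permute σ (Matrix.of fun x => r (f x))
    rw [e1, e2, Equiv.prod_comp σ fun x => w (f x)]
    ring
  have h3 := Finset.sum_congr rfl fun σ (_ : σ ∈ (Finset.univ : Finset (Equiv.Perm d))) => h2 σ
  rw [Finset.sum_const, Finset.card_univ, Fintype.card_perm, nsmul_eq_mul] at h3
  rw [h3, Finset.sum_comm]
  refine Finset.sum_congr rfl fun f _ => ?_
  rw [← Finset.mul_sum, ← Finset.sum_mul, sq]
  congr 2
  rw [det_apply']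
  rfl

theorem isHomPosynomial_det {k : ℕ} {d : Type} [Fintype d] [DecidableEq d]
    {A : Fin k → Matrix d d ℝ} (hA : ∀ j, (A j).PosSemidef) :
    IsHomPosynomial (Fintype.card d) fun t => (∑ j, t j • A j).det := by
  choose r R hR using fun j => posSemidef_iff_eq_sum_vecMulVec.1 (hA j)
  have h1 : ∀ t : Fin k → ℝ, ∑ j, t j • A j =
      ∑ q : (j : Fin k) × Fin (r j), t q.1 • vecMulVec (R q.1 q.2) (R q.1 q.2) := fun t => by
    rw [Fintype.sum_sigma]
    refine Finset.sum_congr rfl fun j _ => ?_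
    rw [hR, Finset.smul_sum]
    simp only [star_trivial]
  have h2 : ∀ t : Fin k → ℝ, (∑ j, t j • A j).det = ∑ f : d → (j : Fin k) × Fin (r j),
      ((Matrix.of fun x => R (f x).1 (f x).2).det ^ 2 / (Fintype.card d).factorial) *
        ∏ x, t (f x).1 := fun t => by
    have h := factorial_mul_det_sum_smul_vecMulVec (fun q : (j : Fin k) × Fin (r j) => t q.1)
      (fun q => R q.1 q.2)
    rw [← h1] at h
    have h0 : ((Fintype.card d).factorial : ℝ) ≠ 0 := Nat.cast_ne_zero.2 (Nat.factorial_ne_zero _)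
    rw [← mul_right_inj' h0, h, Finset.mul_sum]
    refine Finset.sum_congr rfl fun f _ => ?_
    field_simp
  simp only [h2]
  exact IsHomPosynomial.sum _ fun f _ =>
    (IsHomPosynomial.prod_apply Finset.univ fun x => (f x).1).const_mul (by positivity)

end Determinant

section SchurComplement

theorem det_fromBlocks_conj {p q R : Type*} [Fintype p] [Fintype q] [DecidableEq p]
    [DecidableEq q] [CommRing R] (M : Matrix (p ⊕ q) (p ⊕ q) R)
    (hM : IsUnit M.toBlocks₂₂.det) (c : p → R) {V : Matrix (p ⊕ q) (Unit ⊕ q) R}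
    (hV : V = fromBlocks (replicateCol Unit c) 0 0 1) :
    (Vᵀ * M * V).det = M.toBlocks₂₂.det *
        (c ⬝ᵥ (M.toBlocks₁₁ - M.toBlocks₁₂ * M.toBlocks₂₂⁻¹ * M.toBlocks₂₁) *ᵥ c) := by
  let := invertibleOfIsUnitDet _ hM
  conv_lhs => rw [← fromBlocks_toBlocks M]
  rw [hV, fromBlocks_transpose, fromBlocks_multiply, fromBlocks_multiply]
  simp only [transpose_zero, Matrix.mul_zero, Matrix.zero_mul, add_zero, zero_add,
    transpose_one, Matrix.one_mul, Matrix.mul_one]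
  rw [det_fromBlocks₂₂, invOf_eq_nonsing_inv, det_unique (n := Unit)]
  congr 1
  have : (replicateCol Unit c)ᵀ * M.toBlocks₁₁ * replicateCol Unit c -
      (replicateCol Unit c)ᵀ * M.toBlocks₁₂ * M.toBlocks₂₂⁻¹ *
        (M.toBlocks₂₁ * replicateCol Unit c) = (replicateCol Unit c)ᵀ *
      ((M.toBlocks₁₁ - M.toBlocks₁₂ * M.toBlocks₂₂⁻¹ * M.toBlocks₂₁) * replicateCol Unit c) := by
    simp only [Matrix.sub_mul, Matrix.mul_sub, Matrix.mul_assoc]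
  rw [this]
  simp [mul_apply, dotProduct, mulVec]

variable (B : Fin l → Matrix (Fin m ⊕ Fin (n - m)) (Fin m ⊕ Fin (n - m)) ℝ)

theorem isHomPosynomial_det_toBlocks₂₂ (hB : ∀ j, (B j).PosSemidef) :
    IsHomPosynomial (n - m) fun t => (Bt B t).toBlocks₂₂.det := by
  have h := isHomPosynomial_det (A := fun j => (B j).toBlocks₂₂)
    fun j => (hB j).submatrix Sum.inr
  rw [Fintype.card_fin] at h
  convert h using 3 with t
  ext x y
  simp [Bt, toBlocks₂₂, Matrix.sum_apply]

theorem det_toBlocks₂₂_pos {t : Fin l → ℝ} (h : (Bt B t).PosDef) :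
    0 < (Bt B t).toBlocks₂₂.det :=
  (h.submatrix Sum.inr_injective).det_pos

theorem exists_isHomPosynomial_trace (hB : ∀ j, (B j).PosSemidef)
    {C : Matrix (Fin m) (Fin m) ℝ} (hC : C.PosSemidef) :
    ∃ Q : (Fin l → ℝ) → ℝ, IsHomPosynomial (n - m + 1) Q ∧
      ∀ t, (Bt B t).PosDef → (Bt B t).toBlocks₂₂.det * (C * schurBt B t).trace = Q t := by
  obtain ⟨r, c, rfl⟩ := posSemidef_iff_eq_sum_vecMulVec.1 hC
  let V : Fin r → Matrix (Fin m ⊕ Fin (n - m)) (Unit ⊕ Fin (n - m)) ℝ := fun i =>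
    fromBlocks (replicateCol Unit (c i)) 0 0 1
  refine ⟨fun t => ∑ i, (∑ j, t j • ((V i)ᵀ * B j * V i)).det,
    IsHomPosynomial.sum _ fun i _ => ?_, fun t ht => ?_⟩
  · have h := isHomPosynomial_det (A := fun j => (V i)ᵀ * B j * V i)
      fun j => (hB j).conjTranspose_mul_mul_same (V i)
    rwa [Fintype.card_sum, Fintype.card_unit, Fintype.card_fin, add_comm] at h
  · rw [Finset.sum_mul, trace_sum, Finset.mul_sum]
    refine Finset.sum_congr rfl fun i _ => ?_
    have h : ∑ j, t j • ((V i)ᵀ * B j * V i) = (V i)ᵀ * Bt B t * V i := by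
      simp [Bt, Matrix.mul_sum, Matrix.sum_mul]
    rw [h, det_fromBlocks_conj _ (det_toBlocks₂₂_pos B ht).ne'.isUnit (c i) rfl, star_trivial,
      vecMulVec_mul, trace_vecMulVec, dotProduct_mulVec, dotProduct_comm]
    rfl

end SchurComplement

section Projective

variable {k : ℕ}

theorem posOrthant_eq_range_exp_neg :
    posOrthant k = (fun (u : Fin k → ℝ) j => Real.exp (-u j)) '' Set.univ := by
  ext t
  refine ⟨fun ht => ⟨fun j => -Real.log (t j), Set.mem_univ _, funext fun j => ?_⟩, ?_⟩
  · simp [Real.exp_log (ht j)]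
  · rintro ⟨u, -, rfl⟩ j
    exact Real.exp_pos _

theorem setIntegral_posOrthant_exp_neg (g : (Fin k → ℝ) → ℂ) :
    (IntegrableOn g (posOrthant k) ↔
      Integrable fun u : Fin k → ℝ => Real.exp (-∑ j, u j) • g fun j => Real.exp (-u j)) ∧
    ∫ t in posOrthant k, g t = ∫ u : Fin k → ℝ, Real.exp (-∑ j, u j) • g fun j =>
      Real.exp (-u j) := by
  let f' : (Fin k → ℝ) → (Fin k → ℝ) →L[ℝ] (Fin k → ℝ) := fun u =>
    ContinuousLinearMap.pi fun j =>
      (ContinuousLinearMap.toSpanSingleton ℝ (-Real.exp (-u j))).comp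
        (ContinuousLinearMap.proj j)
  have hf' : ∀ u ∈ (Set.univ : Set (Fin k → ℝ)),
      HasFDerivWithinAt (fun (u : Fin k → ℝ) j => Real.exp (-u j)) (f' u) Set.univ u :=
    fun u _ => HasFDerivAt.hasFDerivWithinAt <| hasFDerivAt_pi.2 fun j => by
      have h : HasDerivAt (fun x : ℝ => Real.exp (-x)) (-Real.exp (-u j)) (u j) := by
        simpa using (hasDerivAt_neg (u j)).exp
      have h' : HasFDerivAt (fun u : Fin k → ℝ => u j) (ContinuousLinearMap.proj (R := ℝ) j) u :=
        hasFDerivAt_apply j u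
      exact HasFDerivAt.comp u (g := fun x : ℝ => Real.exp (-x)) h.hasFDerivAt h'
  have hinj : Set.InjOn (fun (u : Fin k → ℝ) j => Real.exp (-u j)) Set.univ :=
    fun u _ u' _ h => funext fun j => neg_injective (Real.exp_injective (congrFun h j))
  have hdet : ∀ u, |(f' u).det| = Real.exp (-∑ j, u j) := fun u => by
    simp only [f', ContinuousLinearMap.det_pi, ContinuousLinearMap.det_toSpanSingleton]
    rw [Finset.abs_prod, ← Finset.sum_neg_distrib, Real.exp_sum]
    simp
  have h1 := integrableOn_image_iff_integrableOn_abs_det_fderiv_smul volume MeasurableSet.univ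
    hf' hinj g
  have h2 := integral_image_eq_integral_abs_det_fderiv_smul volume MeasurableSet.univ
    hf' hinj g
  simp only [hdet, ← posOrthant_eq_range_exp_neg, integrableOn_univ, setIntegral_univ] at h1 h2
  exact ⟨h1, h2⟩

/-- Shearing along the diagonal. -/
def diagonalShear (k : ℕ) : ℝ × (Fin k → ℝ) ≃ᵐ (Fin (k + 1) → ℝ) :=
  MeasurableEquiv.trans
    { toFun := fun x => (x.1, x.2 + fun _ => x.1)
      invFun := fun x => (x.1, x.2 - fun _ => x.1)
      left_inv := fun x => by simp
      right_inv := fun x => by simp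
      measurable_toFun := by
        change Measurable fun x : ℝ × (Fin k → ℝ) => (x.1, x.2 + fun _ => x.1)
        fun_prop
      measurable_invFun := by
        change Measurable fun x : ℝ × (Fin k → ℝ) => (x.1, x.2 - fun _ => x.1)
        fun_prop }
    (MeasurableEquiv.piFinSuccAbove (fun _ : Fin (k + 1) => ℝ) 0).symm

theorem diagonalShear_apply (r : ℝ) (v : Fin k → ℝ) :
    diagonalShear k (r, v) = (0 : Fin (k + 1)).insertNth r (v + fun _ => r) :=
  rfl

theorem measurePreserving_diagonalShear : MeasurePreserving (diagonalShear k) := by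
  refine MeasurePreserving.trans (μb := volume) ?_
    (volume_preserving_piFinSuccAbove (fun _ : Fin (k + 1) => ℝ) 0).symm
  refine (MeasurePreserving.id (volume : Measure ℝ)).skew_product
    (g := fun (r : ℝ) (v : Fin k → ℝ) => v + fun _ => r) ?_
    (Filter.Eventually.of_forall fun r => ?_)
  · change Measurable fun x : ℝ × (Fin k → ℝ) => x.2 + fun _ => x.1
    fun_prop
  · exact (measurePreserving_add_right volume _).map_eq

theorem dotProduct_diagonalShear (e : Fin (k + 1) → ℝ) (r : ℝ) (v : Fin k → ℝ) :
    e ⬝ᵥ diagonalShear k (r, v) = (∑ j, e j) * r + (fun i => e (Fin.succ i)) ⬝ᵥ v := by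
  rw [diagonalShear_apply, dotProduct_insertNth, Fin.sum_univ_succ, dotProduct_add]
  simp [dotProduct, add_mul, Finset.sum_mul]
  ring

theorem posynomial_diagonalShear {κ : Type*} [Fintype κ] {N : ℕ} (c : κ → ℝ)
    {e : κ → Fin (k + 1) → ℝ} (he : ∀ q, ∑ j, e q j = N) (r : ℝ) (v : Fin k → ℝ) :
    posynomial c e (diagonalShear k (r, v)) =
      Real.exp (-(N * r)) * posynomial c (fun q i => e q (Fin.succ i)) v := by
  rw [posynomial, posynomial, Finset.mul_sum]
  refine Finset.sum_congr rfl fun q _ => ?_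
  rw [dotProduct_diagonalShear, he, neg_add, Real.exp_add]
  ring

theorem integral_cexp_neg_mul_exp_neg {z : ℂ} (hz : 0 < z.re) {x : ℝ} (hx : 0 < x) :
    ∫ r : ℝ, Complex.exp (-(z * r)) * Complex.exp (-((x * Real.exp (-r) : ℝ) : ℂ)) =
      Complex.Gamma z * Complex.exp (-(z * Real.log x)) := by
  have hrange : (fun r : ℝ => Real.exp (-r)) '' Set.univ = Set.Ioi 0 := by
    ext t
    refine ⟨?_, fun ht => ⟨-Real.log t, Set.mem_univ _, by simp [Real.exp_log ht]⟩⟩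
    rintro ⟨r, -, rfl⟩
    exact Real.exp_pos _
  have h := integral_image_eq_integral_abs_deriv_smul (f := fun r : ℝ => Real.exp (-r))
    (f' := fun r => -Real.exp (-r)) MeasurableSet.univ
    (fun r _ => HasDerivAt.hasDerivWithinAt (by simpa using (hasDerivAt_neg r).exp))
    (fun u _ u' _ h => neg_injective (Real.exp_injective h))
    (fun t : ℝ => (t : ℂ) ^ (z - 1) * Complex.exp (-(x * t)))
  rw [hrange, Complex.integral_cpow_mul_exp_neg_mul_Ioi hz hx, setIntegral_univ] at h
  have h1 : (1 / (x : ℂ)) ^ z = Complex.exp (-(z * Real.log x)) := by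
    rw [one_div, Complex.cpow_def_of_ne_zero (inv_ne_zero (Complex.ofReal_ne_zero.2 hx.ne')),
      ← Complex.ofReal_inv, ← Complex.ofReal_log (inv_nonneg.2 hx.le), Real.log_inv]
    push_cast
    ring_nf
  rw [mul_comm, ← h1, h]
  refine integral_congr_ae (Filter.Eventually.of_forall fun r => ?_)
  have h2 : ((Real.exp (-r) : ℝ) : ℂ) ^ (z - 1) = Complex.exp (-r * (z - 1)) := by
    rw [Complex.cpow_def_of_ne_zero (Complex.ofReal_ne_zero.2 (Real.exp_pos _).ne'),
      ← Complex.ofReal_log (Real.exp_pos _).le, Real.log_exp]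
    push_cast
    rfl
  have h3 : Complex.exp (-(z * r)) = Complex.exp (-r) * Complex.exp (-r * (z - 1)) := by
    rw [← Complex.exp_add]
    ring_nf
  simp only [h2, h3, abs_neg, Real.abs_exp, Complex.real_smul]
  push_cast
  rw [mul_assoc]

end Projective

section ProjectiveContinuation

variable {k N : ℕ} {κ κ' : Type} [Fintype κ] [Fintype κ']

theorem posynomial_elim_zero (c : κ → ℝ) (β : κ → Fin k → ℝ) (β' : κ' → Fin k → ℝ) :
    posynomial (Sum.elim c 0) (Sum.elim β β') = posynomial c β := by
  ext v
  simp [posynomial]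

theorem posynomial_zero_elim (c : κ' → ℝ) (β : κ → Fin k → ℝ) (β' : κ' → Fin k → ℝ) :
    posynomial (Sum.elim 0 c) (Sum.elim β β') = posynomial c β' := by
  ext v
  simp [posynomial]

theorem exists_coeff_pos_of_posynomial_pos {c : κ → ℝ} {β : κ → Fin k → ℝ} {v : Fin k → ℝ}
    (h : 0 < posynomial c β v) : ∃ q, 0 < c q := by
  by_contra! h'
  exact h.not_ge (Finset.sum_nonpos fun q _ =>
    mul_nonpos_of_nonpos_of_nonneg (h' q) (Real.exp_nonneg _))

theorem integral_diagonalShear {c : κ → ℝ} {e : κ → Fin (k + 1) → ℝ} {c' : κ' → ℝ}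
    {e' : κ' → Fin (k + 1) → ℝ} (he : ∀ q, ∑ j, e q j = N) (he' : ∀ q, ∑ j, e' q j = (N + 1 : ℕ))
    (hc : ∀ q, 0 ≤ c q) (hc' : ∀ q, 0 ≤ c' q) (hpos : ∃ q, 0 < c q) (hpos' : ∃ q, 0 < c' q)
    {s : ℂ} (hs : 0 < s.re) (v : Fin k → ℝ) :
    ∫ r : ℝ, Real.exp (-∑ j, diagonalShear k (r, v) j) •
        (((Real.exp (-(posynomial c' e' (diagonalShear k (r, v)) /
          posynomial c e (diagonalShear k (r, v)))) : ℝ) : ℂ) *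
          ((posynomial c e (diagonalShear k (r, v)) : ℝ) : ℂ) ^ s) =
      Complex.Gamma (k + 1 + N * s) *
        eulerIntegrand (fun i : Bool => bif i then Sum.elim 0 c' else Sum.elim c 0)
          (fun _ => Sum.elim (fun q i => e q (Fin.succ i)) fun q i => e' q (Fin.succ i))
          (fun _ => 1) (fun _ => 0) (fun i => bif i then -N else 1 + N)
          (fun i => bif i then -(k + 1) else k + 1) s v := by
  have hP : 0 < posynomial c (fun q i => e q (Fin.succ i)) v := posynomial_pos hc hpos _ v
  have hV : 0 < posynomial c' (fun q i => e' q (Fin.succ i)) v := posynomial_pos hc' hpos' _ v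
  have hz : 0 < ((k : ℂ) + 1 + N * s).re := by
    simp only [Complex.add_re, Complex.natCast_re, Complex.one_re, Complex.mul_re,
      Complex.natCast_im, zero_mul, sub_zero]
    positivity
  simp only [posynomial_diagonalShear c he, posynomial_diagonalShear c' he', eulerIntegrand,
    Fintype.sum_bool, cond_true, cond_false, posynomial_elim_zero, posynomial_zero_elim]
  set P := posynomial c (fun q i => e q (Fin.succ i)) v
  set V := posynomial c' (fun q i => e' q (Fin.succ i)) v
  have hsum : ∀ r : ℝ, ∑ j, diagonalShear k (r, v) j = (k + 1) * r + ∑ i, v i := fun r => by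
    simpa [dotProduct] using dotProduct_diagonalShear (fun _ => (1 : ℝ)) r v
  have h_int : ∀ r : ℝ, Real.exp (-∑ j, diagonalShear k (r, v) j) •
      (((Real.exp (-(Real.exp (-((N + 1 : ℕ) * r)) * V / (Real.exp (-(N * r)) * P))) : ℝ) : ℂ) *
        ((Real.exp (-(N * r)) * P : ℝ) : ℂ) ^ s) =
      Complex.exp (-((k + 1 + N * s) * r)) *
        Complex.exp (-((V / P * Real.exp (-r) : ℝ) : ℂ)) *
        Complex.exp (-((∑ i, v i : ℝ) : ℂ) + s * Real.log P) := fun r => by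
    have h1 : Real.exp (-((N + 1 : ℕ) * r)) * V / (Real.exp (-(N * r)) * P) =
        V / P * Real.exp (-r) := by
      rw [show -(((N + 1 : ℕ) : ℝ) * r) = -(N * r) + -r by push_cast; ring, Real.exp_add]
      field_simp
    have hpos : 0 < Real.exp (-(N * r)) * P := mul_pos (Real.exp_pos _) hP
    rw [h1, hsum, Complex.cpow_def_of_ne_zero (Complex.ofReal_ne_zero.2 hpos.ne'),
      ← Complex.ofReal_log hpos.le, Real.log_mul (Real.exp_pos _).ne' hP.ne', Real.log_exp,
      Complex.real_smul, Complex.ofReal_exp, Complex.ofReal_exp, ← Complex.exp_add,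
      ← Complex.exp_add, ← Complex.exp_add, ← Complex.exp_add]
    push_cast
    ring_nf
  simp only [h_int]
  rw [integral_mul_const, integral_cexp_neg_mul_exp_neg hz (div_pos hV hP),
    Real.log_div hV.ne' hP.ne', mul_assoc, ← Complex.exp_add]
  congr 2
  simp only [dotProduct, one_mul, zero_mul, Finset.sum_const_zero]
  push_cast
  ring

theorem exists_meromorphic_of_isHomPosynomial {p U : (Fin (k + 1) → ℝ) → ℝ}
    (hp : IsHomPosynomial N p) (hU : IsHomPosynomial (N + 1) U)
    (hp0 : ∀ t ∈ posOrthant (k + 1), 0 < p t) (hU0 : ∀ t ∈ posOrthant (k + 1), 0 < U t)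
    (h_int : ∀ s : ℂ, 0 < s.re → IntegrableOn
      (fun t => ((Real.exp (-(U t / p t)) : ℝ) : ℂ) * ((p t : ℝ) : ℂ) ^ s)
      (posOrthant (k + 1))) :
    ∃ G : ℂ → ℂ, Meromorphic G ∧ ∀ s : ℂ, 0 < s.re → G s = ∫ t in posOrthant (k + 1),
      ((Real.exp (-(U t / p t)) : ℝ) : ℂ) * ((p t : ℝ) : ℂ) ^ s := by
  obtain ⟨κ, _, c, e, hc, he, hp⟩ := hp
  obtain ⟨κ', _, c', e', hc', he', hU⟩ := hU
  have h1 : (fun j => Real.exp (-(0 : Fin (k + 1) → ℝ) j)) ∈ posOrthant (k + 1) :=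
    fun j => Real.exp_pos _
  have hpos : ∃ q, 0 < c q := exists_coeff_pos_of_posynomial_pos ((hp0 _ h1).trans_eq (hp 0))
  have hpos' : ∃ q, 0 < c' q := exists_coeff_pos_of_posynomial_pos ((hU0 _ h1).trans_eq (hU 0))
  let W : ℂ → (Fin k → ℝ) → ℂ :=
    eulerIntegrand (fun i : Bool => bif i then Sum.elim 0 c' else Sum.elim c 0)
      (fun _ => Sum.elim (fun q i => e q (Fin.succ i)) fun q i => e' q (Fin.succ i))
      (fun _ => 1) (fun _ => 0) (fun i => bif i then -N else 1 + N)
      (fun i => bif i then -(k + 1) else k + 1)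
  have key : ∀ s : ℂ, 0 < s.re → Integrable (W s) ∧ ∫ t in posOrthant (k + 1),
      ((Real.exp (-(U t / p t)) : ℝ) : ℂ) * ((p t : ℝ) : ℂ) ^ s =
        Complex.Gamma (k + 1 + N * s) * ∫ v, W s v := fun s hs => by
    have hz : 0 < ((k : ℂ) + 1 + N * s).re := by
      simp only [Complex.add_re, Complex.natCast_re, Complex.one_re, Complex.mul_re,
        Complex.natCast_im, zero_mul, sub_zero]
      positivity
    obtain ⟨h1, h2⟩ := setIntegral_posOrthant_exp_neg fun t : Fin (k + 1) → ℝ =>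
      ((Real.exp (-(U t / p t)) : ℝ) : ℂ) * ((p t : ℝ) : ℂ) ^ s
    have h3 := h1.1 (h_int s hs)
    rw [h2]
    simp only [hp, hU] at h3 ⊢
    rw [← measurePreserving_diagonalShear.integral_comp (diagonalShear k).measurableEmbedding]
    rw [← measurePreserving_diagonalShear.integrable_comp_emb
      (diagonalShear k).measurableEmbedding] at h3
    have h4 := h3.integral_prod_right
    simp only [Function.comp_def, integral_diagonalShear he he' hc hc' hpos hpos' hs] at h4
    refine ⟨?_, ?_⟩
    · exact (integrable_const_mul_iff (IsUnit.mk0 _ (Complex.Gamma_ne_zero_of_re_pos hz)) _).1 h4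
    · refine (integral_prod_symm _ h3).trans ?_
      simp only [Function.comp_def, integral_diagonalShear he he' hc hc' hpos hpos' hs]
      exact integral_const_mul _ _
  obtain ⟨G, hG, hGW⟩ := HasContinuation.exists_meromorphic fun M : ℕ =>
    hasContinuation_integral M (c := fun i : Bool => bif i then Sum.elim 0 c' else Sum.elim c 0)
      (by
        rintro (_ | _) (q | q)
        exacts [hc q, le_rfl, le_rfl, hc' q])
      (by
        rintro (_ | _)
        exacts [⟨Sum.inl hpos.choose, hpos.choose_spec⟩, ⟨Sum.inr hpos'.choose, hpos'.choose_spec⟩])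
      _ _ _ _ _ fun s hs => (key s hs).1
  refine ⟨fun s => Complex.Gamma (k + 1 + N * s) * G s, ?_, fun s hs => ?_⟩
  · refine Meromorphic.mul (fun s => ?_) hG
    exact (Meromorphic.Gamma _).comp_analyticAt (f := Complex.Gamma)
      (g := fun s : ℂ => (k : ℂ) + 1 + N * s) (by fun_prop)
  · simp only [(key s hs).2, hGW s hs, W]

end ProjectiveContinuation

section Growth

variable {k : ℕ}

theorem IsHomPosynomial.nonneg {N : ℕ} {g : (Fin k → ℝ) → ℝ} (hg : IsHomPosynomial N g)
    {t : Fin k → ℝ} (ht : t ∈ posOrthant k) : 0 ≤ g t := by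
  obtain ⟨κ, _, c, e, hc, -, hg⟩ := hg
  obtain ⟨u, -, rfl⟩ := posOrthant_eq_range_exp_neg (k := k) ▸ ht
  rw [hg]
  exact Finset.sum_nonneg fun q _ => mul_nonneg (hc q) (Real.exp_nonneg _)

theorem IsHomPosynomial.continuousOn {N : ℕ} {g : (Fin k → ℝ) → ℝ} (hg : IsHomPosynomial N g) :
    ContinuousOn g (posOrthant k) := by
  obtain ⟨κ, _, c, e, -, -, hg⟩ := hg
  have h : ContinuousOn (fun (t : Fin k → ℝ) j => -Real.log (t j)) (posOrthant k) :=
    continuousOn_pi.2 fun j =>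
      ((continuous_apply j).continuousOn.log fun t ht => (ht j).ne').neg
  refine ((continuous_posynomial c e).comp_continuousOn h).congr fun t ht => ?_
  rw [Function.comp_apply, ← hg]
  simp [Real.exp_log (ht _)]

/-- A positive function of subexponential growth times a decaying exponential. -/
theorem exists_integrable_bound {x : Fin k → ℝ} (hx : ∀ j, 0 < x j) {p h : (Fin k → ℝ) → ℝ}
    (hp0 : ∀ t ∈ posOrthant k, 0 < p t)
    (hp : ∀ ε > 0, ∃ A, ∀ t ∈ posOrthant k, p t ≤ A * Real.exp (ε * ∑ j, t j))
    (hh : ∀ t ∈ posOrthant k, x ⬝ᵥ t ≤ h t) {R : ℝ} (hR : 0 < R) :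
    ∃ g : (Fin k → ℝ) → ℝ, IntegrableOn g (posOrthant k) ∧ ∀ t ∈ posOrthant k, ∀ s : ℂ,
      0 < s.re → s.re ≤ R →
        ‖((Real.exp (-h t) : ℝ) : ℂ) * ((p t : ℝ) : ℂ) ^ s‖ ≤ g t := by
  obtain ⟨μ, hμ, hμx⟩ := Pi.exists_forall_pos_add_lt (x := fun _ => (0 : ℝ)) hx
  obtain ⟨A, hA⟩ := hp (μ / R) (by positivity)
  refine ⟨fun t => max A 1 ^ R * Real.exp (-((fun j => x j - μ) ⬝ᵥ t)),
    (integrableOn_exp_neg_dotProduct fun j => by linarith [hμx j]).const_mul _,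
    fun t ht s hs hsR => ?_⟩
  have hτ : 0 ≤ ∑ j, t j := Finset.sum_nonneg fun j _ => (ht j).le
  have h1 : 1 ≤ max A 1 * Real.exp (μ / R * ∑ j, t j) :=
    one_le_mul_of_one_le_of_one_le (le_max_right _ _) (Real.one_le_exp (by positivity))
  have h2 : p t ≤ max A 1 * Real.exp (μ / R * ∑ j, t j) :=
    (hA t ht).trans (mul_le_mul_of_nonneg_right (le_max_left _ _) (Real.exp_nonneg _))
  have h3 : p t ^ s.re ≤ max A 1 ^ R * Real.exp (μ * ∑ j, t j) := by
    refine (Real.rpow_le_rpow (hp0 t ht).le h2 hs.le).trans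
      ((Real.rpow_le_rpow_of_exponent_le h1 hsR).trans_eq ?_)
    rw [Real.mul_rpow (by positivity) (Real.exp_nonneg _), ← Real.exp_mul]
    congr 2
    field_simp
  rw [norm_mul, Complex.norm_cpow_eq_rpow_re_of_pos (hp0 t ht), Complex.norm_real,
    Real.norm_of_nonneg (Real.exp_nonneg _), mul_comm]
  have h4 : -((fun j => x j - μ) ⬝ᵥ t) = μ * ∑ j, t j + -(x ⬝ᵥ t) := by
    simp only [dotProduct, sub_mul, Finset.sum_sub_distrib, ← Finset.mul_sum]
    ring
  simp only [h4, Real.exp_add]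
  rw [← mul_assoc]
  exact mul_le_mul h3 (Real.exp_le_exp.2 (neg_le_neg (hh t ht))) (Real.exp_nonneg _)
    (by positivity)

theorem integrableOn_and_differentiableOn {x : Fin k → ℝ} (hx : ∀ j, 0 < x j)
    {p h : (Fin k → ℝ) → ℝ} (hp0 : ∀ t ∈ posOrthant k, 0 < p t)
    (hp : ∀ ε > 0, ∃ A, ∀ t ∈ posOrthant k, p t ≤ A * Real.exp (ε * ∑ j, t j))
    (hh : ∀ t ∈ posOrthant k, x ⬝ᵥ t ≤ h t) (hpc : ContinuousOn p (posOrthant k))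
    (hhc : ContinuousOn h (posOrthant k)) :
    (∀ s : ℂ, 0 < s.re → IntegrableOn
      (fun t => ((Real.exp (-h t) : ℝ) : ℂ) * ((p t : ℝ) : ℂ) ^ s) (posOrthant k)) ∧
    DifferentiableOn ℂ (fun s => ∫ t in posOrthant k,
      ((Real.exp (-h t) : ℝ) : ℂ) * ((p t : ℝ) : ℂ) ^ s) {s : ℂ | 0 < s.re} := by
  have hmeas : ∀ s : ℂ, AEStronglyMeasurable
      (fun t => ((Real.exp (-h t) : ℝ) : ℂ) * ((p t : ℝ) : ℂ) ^ s)
      (volume.restrict (posOrthant k)) := fun s => by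
    refine ContinuousOn.aestronglyMeasurable ?_ (measurableSet_posOrthant k)
    refine ContinuousOn.mul (Complex.continuous_ofReal.comp_continuousOn hhc.neg.rexp) ?_
    exact (Complex.continuous_ofReal.comp_continuousOn hpc).cpow_const
      fun t ht => Complex.ofReal_mem_slitPlane.2 (hp0 t ht)
  have hmem : ∀ᵐ t ∂volume.restrict (posOrthant k), t ∈ posOrthant k :=
    ae_restrict_mem (measurableSet_posOrthant k)
  refine ⟨fun s hs => ?_, differentiableOn_integral_of_dominated
    (isOpen_lt continuous_const Complex.continuous_re) (fun s _ => hmeas s) ?_ fun s₀ hs₀ => ?_⟩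
  · obtain ⟨g, hg, hgb⟩ := exists_integrable_bound hx hp0 hp hh hs
    exact Integrable.mono' hg (hmeas s) (hmem.mono fun t ht => hgb t ht s hs le_rfl)
  · filter_upwards [hmem] with t ht
    refine Differentiable.differentiableOn ?_
    exact (differentiable_id.const_cpow
      (Or.inl (Complex.ofReal_ne_zero.2 (hp0 t ht).ne'))).const_mul _
  · have hs₀' : 0 < s₀.re := hs₀
    obtain ⟨g, hg, hgb⟩ := exists_integrable_bound hx hp0 hp hh (R := 2 * s₀.re) (by linarith)
    refine ⟨s₀.re, hs₀', g, hg, hmem.mono fun t ht s hs => ?_⟩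
    have h := (Complex.abs_re_le_norm (s - s₀)).trans_lt (mem_ball_iff_norm.1 hs)
    rw [Complex.sub_re, abs_lt] at h
    exact hgb t ht s (by linarith) (by linarith)

theorem det_sum_smul_le {ν : Type*} [Fintype ν] [DecidableEq ν] (A : Fin k → Matrix ν ν ℝ)
    {ε : ℝ} (hε : 0 < ε) : ∃ K, ∀ t ∈ posOrthant k,
      (∑ j, t j • A j).det ≤ K * Real.exp (ε * ∑ j, t j) := by
  set a : ℝ := ∑ j, ∑ x, ∑ y, |A j x y|
  have ha : ∀ j x y, |A j x y| ≤ a := fun j x y =>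
    (Finset.single_le_sum (fun _ _ => abs_nonneg _) (Finset.mem_univ y)).trans <|
      (Finset.single_le_sum (f := fun x => ∑ y, |A j x y|)
        (fun _ _ => Finset.sum_nonneg fun _ _ => abs_nonneg _) (Finset.mem_univ x)).trans <|
      Finset.single_le_sum (f := fun j => ∑ x, ∑ y, |A j x y|)
        (fun _ _ => Finset.sum_nonneg fun _ _ => Finset.sum_nonneg fun _ _ => abs_nonneg _)
        (Finset.mem_univ j)
  set d := Fintype.card ν
  refine ⟨d.factorial * ((a / ε) ^ d * d.factorial), fun t ht => ?_⟩
  have hτ : 0 ≤ ∑ j, t j := Finset.sum_nonneg fun j _ => (ht j).le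
  have ha0 : 0 ≤ a := by positivity
  have h1 : ∀ x y, |(∑ j, t j • A j) x y| ≤ a / ε * (ε * ∑ j, t j) := fun x y => by
    have h2 : a / ε * (ε * ∑ j, t j) = ∑ j, t j * a := by
      rw [← Finset.sum_mul]
      field_simp
    rw [h2, Matrix.sum_apply]
    refine (Finset.abs_sum_le_sum_abs _ _).trans (Finset.sum_le_sum fun j _ => ?_)
    rw [Matrix.smul_apply, smul_eq_mul, abs_mul, abs_of_pos (ht j)]
    exact mul_le_mul_of_nonneg_left (ha j x y) (ht j).le
  have h3 := det_le (abv := AbsoluteValue.abs) h1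
  rw [nsmul_eq_mul, mul_pow] at h3
  have h4 := Real.pow_div_factorial_le_exp (ε * ∑ j, t j) (by positivity) d
  rw [div_le_iff₀ (by positivity)] at h4
  refine (le_abs_self _).trans (h3.trans ?_)
  rw [mul_assoc, mul_assoc, mul_comm (d.factorial : ℝ) (Real.exp _)]
  gcongr

end Growth

/-- The parametric (Schwinger) representation of the `D`-dimensional integral
of the Feynman type function `f(A) = ∏_j (tr(A B_j) + m_j²)^{−1}`:
`F(D) = ∫_{(0,∞)ˡ} exp(−Σ_j t_j m_j² − tr(C·S(B(t)))) (det B(t)₂₂)^{−D/2} dt` is well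
defined and holomorphic on `{Re D < 0}`, and admits a meromorphic continuation to `ℂ`. -/
theorem feynman_parametric_meromorphic (m n l : ℕ) (hm : 0 < m) (hmn : m < n) (hl : 1 ≤ l)
    (B : Fin l → Matrix (Fin m ⊕ Fin (n - m)) (Fin m ⊕ Fin (n - m)) ℝ)
    (hB : ∀ j, (B j).PosSemidef)
    (hBpos : ∀ t : Fin l → ℝ, (∀ i, 0 < t i) → (Bt B t).PosDef)
    (mj : Fin l → ℝ) (hmj : ∀ j, 0 < mj j)
    (C : Matrix (Fin m) (Fin m) ℝ) (hC : C.PosSemidef) :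
    (∀ D : ℂ, D.re < 0 →
      IntegrableOn (feynmanIntegrand B mj C D) {t : Fin l → ℝ | ∀ i, 0 < t i} volume) ∧
    DifferentiableOn ℂ
      (fun D : ℂ => ∫ t in {t : Fin l → ℝ | ∀ i, 0 < t i}, feynmanIntegrand B mj C D t)
      {D : ℂ | D.re < 0} ∧
    ∃ G : ℂ → ℂ, MeromorphicOn G Set.univ ∧
      ∀ D : ℂ, D.re < 0 →
        G D = ∫ t in {t : Fin l → ℝ | ∀ i, 0 < t i}, feynmanIntegrand B mj C D t := by
  obtain ⟨k, rfl⟩ : ∃ k, l = k + 1 := ⟨l - 1, by omega⟩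
  have hmj2 : ∀ j, 0 < mj j ^ 2 := fun j => pow_pos (hmj j) 2
  set p : (Fin (k + 1) → ℝ) → ℝ := fun t => (Bt B t).toBlocks₂₂.det with hp_def
  have hp : IsHomPosynomial (n - m) p := isHomPosynomial_det_toBlocks₂₂ B hB
  have hp0 : ∀ t ∈ posOrthant (k + 1), 0 < p t := fun t ht => det_toBlocks₂₂_pos B (hBpos t ht)
  obtain ⟨Q, hQ, hQeq⟩ := exists_isHomPosynomial_trace B hB hC
  set U : (Fin (k + 1) → ℝ) → ℝ := fun t => p t * ∑ j, mj j ^ 2 * t j + Q t with hU_def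
  have hU : IsHomPosynomial (n - m + 1) U :=
    (hp.mul (IsHomPosynomial.sum _ fun j _ =>
      (IsHomPosynomial.apply j).const_mul (hmj2 j).le)).add hQ
  have hsum : ∀ t ∈ posOrthant (k + 1), 0 < ∑ j, mj j ^ 2 * t j := fun t ht =>
    Finset.sum_pos (fun j _ => mul_pos (hmj2 j) (ht j)) Finset.univ_nonempty
  have hU0 : ∀ t ∈ posOrthant (k + 1), 0 < U t := fun t ht =>
    add_pos_of_pos_of_nonneg (mul_pos (hp0 t ht) (hsum t ht)) (hQ.nonneg ht)
  have hgrowth : ∀ ε > 0, ∃ K, ∀ t ∈ posOrthant (k + 1), p t ≤ K * Real.exp (ε * ∑ j, t j) :=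
    fun ε hε => by
      obtain ⟨K, hK⟩ := det_sum_smul_le (fun j => (B j).toBlocks₂₂) hε
      refine ⟨K, fun t ht => (hK t ht).trans_eq' ?_⟩
      congr 1
      ext x y
      simp [Bt, toBlocks₂₂, Matrix.sum_apply]
  have hle : ∀ t ∈ posOrthant (k + 1), (fun j => mj j ^ 2) ⬝ᵥ t ≤ U t / p t := fun t ht => by
    rw [le_div_iff₀ (hp0 t ht), mul_comm]
    exact le_add_of_nonneg_right (hQ.nonneg ht)
  obtain ⟨h_int, hdiff⟩ := integrableOn_and_differentiableOn hmj2 hp0 hgrowth hle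
    hp.continuousOn (hU.continuousOn.div hp.continuousOn fun t ht => (hp0 t ht).ne')
  have heq : ∀ D : ℂ, Set.EqOn (feynmanIntegrand B mj C D)
      (fun t => ((Real.exp (-(U t / p t)) : ℝ) : ℂ) * ((p t : ℝ) : ℂ) ^ (-D / 2))
      (posOrthant (k + 1)) := fun D t ht => by
    have h1 : U t / p t = ∑ j, t j * mj j ^ 2 + (C * schurBt B t).trace := by
      rw [div_eq_iff (hp0 t ht).ne', add_mul, mul_comm _ (p t), mul_comm _ (p t),
        hQeq t (hBpos t ht)]
      simp only [hU_def, mul_comm]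
    simp only [h1, neg_add, ← sub_eq_add_neg]
    rfl
  have hD : ∀ D : ℂ, D.re < 0 → 0 < (-D / 2).re := fun D hD => by
    simpa using hD
  have hset : {t : Fin (k + 1) → ℝ | ∀ i, 0 < t i} = posOrthant (k + 1) := rfl
  have hF : ∀ D : ℂ, ∫ t in posOrthant (k + 1), feynmanIntegrand B mj C D t =
      ∫ t in posOrthant (k + 1),
        ((Real.exp (-(U t / p t)) : ℝ) : ℂ) * ((p t : ℝ) : ℂ) ^ (-D / 2) := fun D =>
    setIntegral_congr_fun (measurableSet_posOrthant (k + 1)) (heq D)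
  simp only [hset, hF]
  obtain ⟨G, hG, hGeq⟩ := exists_meromorphic_of_isHomPosynomial hp hU hp0 hU0 h_int
  refine ⟨fun D h => (integrableOn_congr_fun (heq D)
    (measurableSet_posOrthant (k + 1))).2 (h_int _ (hD D h)), ?_, fun D => G (-D / 2), fun D _ => ?_,
    fun D h => hGeq _ (hD D h)⟩
  · exact hdiff.comp (g := fun s => ∫ t in posOrthant (k + 1),
      ((Real.exp (-(U t / p t)) : ℝ) : ℂ) * ((p t : ℝ) : ℂ) ^ s) (f := fun D : ℂ => -D / 2)
      (s := {D : ℂ | D.re < 0}) (by fun_prop) fun D h => hD D h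
  · exact (hG _).comp_analyticAt (f := G) (g := fun D : ℂ => -D / 2) (by fun_prop)

end
end

section
/- Let n ≥ 1 and, for a multivariate polynomial f over a commutative ring (in n variables) and a natural number m, let P_m f denote the truncation of f to total degree at most m, i.e. the sum of the homogeneous components of f of degree 0, 1, …, m. Then the family of operators (P_m)_{m ∈ ℕ} is a Rota–Baxter family: for all polynomials f, g and all natural numbers s, t one has (P_s f) · (P_t g) = P_{s+t}( (P_s f) · g + f · (P_t g) − f · g ). -/
open MvPolynomial Finset

noncomputable section

/-- The order-`m` Taylor truncation operator: the sum of the homogeneous components of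
degree `0, 1, …, m` of a multivariate polynomial. -/
def taylorTrunc {R : Type*} [CommRing R] {n : ℕ} (m : ℕ)
    (f : MvPolynomial (Fin n) R) : MvPolynomial (Fin n) R :=
  ∑ i ∈ Finset.range (m + 1), MvPolynomial.homogeneousComponent i f

theorem coeff_taylorTrunc {R : Type*} [CommRing R] {n : ℕ} (m : ℕ)
    (f : MvPolynomial (Fin n) R) (d : Fin n →₀ ℕ) :
    coeff d (taylorTrunc m f) = if d.degree ≤ m then coeff d f else 0 := by
  simp [taylorTrunc, coeff_sum, coeff_homogeneousComponent, Order.lt_add_one_iff]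

/-- The truncation operators `(P_m)` form a Rota–Baxter family: for all
multivariate polynomials `f, g` in `n ≥ 1` variables over a commutative ring and all
`s, t ∈ ℕ`, `(P_s f)·(P_t g) = P_{s+t}((P_s f)·g + f·(P_t g) − f·g)`. -/
theorem taylorTrunc_rotaBaxter_family {R : Type*} [CommRing R] (n : ℕ) (hn : 1 ≤ n)
    (f g : MvPolynomial (Fin n) R) (s t : ℕ) :
    taylorTrunc s f * taylorTrunc t g =
      taylorTrunc (s + t) (taylorTrunc s f * g + f * taylorTrunc t g - f * g) := by
  ext d
  rw [coeff_taylorTrunc, coeff_sub, coeff_add]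
  simp only [coeff_mul, coeff_taylorTrunc]
  rw [← sum_add_distrib, ← sum_sub_distrib, ← sum_const_zero (s := antidiagonal d),
    ← sum_ite_irrel]
  refine sum_congr rfl fun p hp => ?_
  have hdeg : p.1.degree + p.2.degree = d.degree := by
    rw [← map_add, mem_antidiagonal.1 hp]
  split_ifs <;> first | omega | simp

end
end
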